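/- arXiv:1811.09183 — 2 statements merged into one kernel-verified Lean document; each statement's English description precedes it below -/
import Mathlib

section
/- Let E_1, …, E_m and F be infinite dimensional Banach spaces, each E_i having cotype 2, and let 1 ≤ r ≤ 2, r ≤ a < ∞, and 1 ≤ s < ∞ satisfy 1/r − 1/a ≤ 1 − 1/s. Then every multiple (a,r)-summing m-linear operator T : E_1 × ⋯ × E_m → F is multiple (s,1)-summing. -/
open scoped ENNReal NNReal BigOperators ZeroAtInfty

noncomputable section

/-- The `k`-th Rademacher function on `[0,1]`. -/
def Rademacher (k : ℕ) (t : ℝ) : ℝ := (-1 : ℝ) ^ ⌊(2 : ℝ) ^ (k + 1) * t⌋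

/-- A Banach space `E` has cotype `q` (for `2 ≤ q < ∞`). -/
def HasCotype (q : ℝ) (E : Type*) [NormedAddCommGroup E] [NormedSpace ℝ E] : Prop :=
  2 ≤ q ∧ ∃ C > 0, ∀ (n : ℕ) (x : Fin n → E),
    (∑ k : Fin n, ‖x k‖ ^ q) ^ (1 / q) ≤
      C * (∫ t in (0:ℝ)..(1:ℝ), ‖∑ k : Fin n, Rademacher k.1 t • x k‖ ^ 2) ^ ((1:ℝ) / 2)

/-- `cot E`, the infimum of the cotypes of `E` (`∞` if `E` has no finite cotype). -/
def cot (E : Type*) [NormedAddCommGroup E] [NormedSpace ℝ E] : ℝ≥0∞ :=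
  sInf {c : ℝ≥0∞ | ∃ q : ℝ, HasCotype q E ∧ c = ENNReal.ofReal q}

/-- Conjugate exponent in `ℝ≥0∞` : `p* = p/(p-1)`, with `1* = ∞` and `∞* = 1`. -/
def conjE (p : ℝ≥0∞) : ℝ≥0∞ := 1 + 1 / (p - 1)

/-- A sequence is weakly `p`-summable. -/
def WeaklySummable {E : Type*} [NormedAddCommGroup E] [NormedSpace ℝ E]
    (p : ℝ) (x : ℕ → E) : Prop :=
  ∀ φ : E →L[ℝ] ℝ, Summable fun j => |φ (x j)| ^ p

/-- `u : E → F` is absolutely `(q,p)`-summing. -/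
def AbsolutelySumming {E F : Type*} [NormedAddCommGroup E] [NormedSpace ℝ E]
    [NormedAddCommGroup F] [NormedSpace ℝ F] (q p : ℝ) (u : E →L[ℝ] F) : Prop :=
  ∀ x : ℕ → E, WeaklySummable p x → Summable fun j => ‖u (x j)‖ ^ q

/-- The weak `ℓ_p` norm of a sequence. -/
def weakNorm {E : Type*} [NormedAddCommGroup E] [NormedSpace ℝ E] (p : ℝ) (x : ℕ → E) : ℝ :=
  ⨆ φ : {φ : E →L[ℝ] ℝ // ‖φ‖ ≤ 1}, (∑' j, |φ.1 (x j)| ^ p) ^ (1 / p)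

/-- A continuous `m`-linear operator is multiple `(q,p)`-summing. -/
def MultipleSumming {m : ℕ} {E : Fin m → Type*} [∀ i, NormedAddCommGroup (E i)]
    [∀ i, NormedSpace ℝ (E i)] {F : Type*} [NormedAddCommGroup F] [NormedSpace ℝ F]
    (q p : ℝ) (T : ContinuousMultilinearMap ℝ E F) : Prop :=
  ∃ C > 0, ∀ x : (i : Fin m) → ℕ → E i, (∀ i, WeaklySummable p (x i)) →
    (Summable fun j : Fin m → ℕ => ‖T (fun i => x i (j i))‖ ^ q) ∧
    (∑' j : Fin m → ℕ, ‖T (fun i => x i (j i))‖ ^ q) ^ (1 / q) ≤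
      C * ∏ i, weakNorm p (x i)

theorem Rademacher_succ (k : ℕ) (t : ℝ) : Rademacher (k + 1) t = Rademacher k (2 * t) := by
  unfold Rademacher
  congr 2
  ring

theorem Rademacher_sub_one (k : ℕ) (t : ℝ) : Rademacher k (t - 1) = Rademacher k t := by
  unfold Rademacher
  have h : (2 : ℝ) ^ (k + 1) * (t - 1) = 2 ^ (k + 1) * t - ((2 ^ (k + 1) : ℤ) : ℝ) := by
    push_cast; ring
  rw [h, Int.floor_sub_intCast, zpow_sub₀ (by norm_num)]
  have h2 : ((-1 : ℝ)) ^ ((2 : ℤ) ^ (k + 1)) = 1 :=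
    Even.neg_one_zpow ((even_two).pow_of_ne_zero (Nat.succ_ne_zero k))
  rw [h2, div_one]

theorem Rademacher_zero_of_lt_half {t : ℝ} (h0 : 0 ≤ t) (h1 : t < 1 / 2) : Rademacher 0 t = 1 := by
  unfold Rademacher
  have : ⌊(2 : ℝ) ^ (0 + 1) * t⌋ = 0 := by
    rw [Int.floor_eq_iff]; constructor <;> norm_num <;> linarith
  rw [this, zpow_zero]

theorem Rademacher_zero_of_half_le {t : ℝ} (h0 : 1 / 2 ≤ t) (h1 : t < 1) :
    Rademacher 0 t = -1 := by
  unfold Rademacher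
  have : ⌊(2 : ℝ) ^ (0 + 1) * t⌋ = 1 := by
    rw [Int.floor_eq_iff]; constructor <;> norm_num <;> linarith
  rw [this, zpow_one]

theorem measurable_Rademacher (k : ℕ) : Measurable (Rademacher k) := by
  unfold Rademacher
  exact (measurable_from_top (f := fun z : ℤ => (-1 : ℝ) ^ z)).comp
    (Int.measurable_floor.comp (measurable_const.mul measurable_id))

theorem abs_Rademacher (k : ℕ) (t : ℝ) : |Rademacher k t| = 1 := by
  unfold Rademacher
  rw [abs_zpow, abs_neg, abs_one, one_zpow]

/-- The Rademacher sum with real coefficients `c`. -/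
def rademacherSum {n : ℕ} (c : Fin n → ℝ) (t : ℝ) : ℝ := ∑ k : Fin n, Rademacher k.1 t * c k

theorem measurable_rademacherSum {n : ℕ} (c : Fin n → ℝ) : Measurable (rademacherSum c) := by
  unfold rademacherSum
  exact Finset.measurable_sum _ fun k _ => (measurable_Rademacher k.1).mul_const _

theorem abs_rademacherSum_le {n : ℕ} (c : Fin n → ℝ) (t : ℝ) :
    |rademacherSum c t| ≤ ∑ k, |c k| := by
  unfold rademacherSum
  refine (Finset.abs_sum_le_sum_abs _ _).trans (Finset.sum_le_sum fun k _ => ?_)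
  rw [abs_mul, abs_Rademacher, one_mul]

theorem intervalIntegrable_comp_rademacherSum {n : ℕ} (c : Fin n → ℝ) {G : ℝ → ℝ}
    (hG : Continuous G) (a b : ℝ) :
    IntervalIntegrable (fun t => G (rademacherSum c t)) MeasureTheory.volume a b := by
  obtain ⟨B, hB⟩ := (isCompact_Icc (a := -∑ k, |c k|) (b := ∑ k, |c k|)).exists_bound_of_continuousOn
    hG.continuousOn
  refine (intervalIntegrable_const (c := B)).mono_fun
    (hG.measurable.comp (measurable_rademacherSum c)).aestronglyMeasurable ?_
  refine Filter.Eventually.of_forall fun t => ?_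
  exact (hB _ (abs_le.1 (abs_rademacherSum_le c t))).trans (le_abs_self B)

theorem rademacherSum_succ {n : ℕ} (c : Fin (n + 1) → ℝ) (t : ℝ) :
    rademacherSum c t = Rademacher 0 t * c 0 + rademacherSum (Fin.tail c) (2 * t) := by
  unfold rademacherSum
  rw [Fin.sum_univ_succ]
  simp [Rademacher_succ, Fin.tail]

theorem rademacherSum_sub_one {n : ℕ} (c : Fin n → ℝ) (t : ℝ) :
    rademacherSum c (t - 1) = rademacherSum c t := by
  simp only [rademacherSum, Rademacher_sub_one]

/-- Conditioning on the first sign of a Rademacher sum. -/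
theorem integral_comp_rademacherSum_succ {n : ℕ} (c : Fin (n + 1) → ℝ) {G : ℝ → ℝ}
    (hG : Continuous G) :
    ∫ t in (0 : ℝ)..1, G (rademacherSum c t) =
      ∫ t in (0 : ℝ)..1, (G (c 0 + rademacherSum (Fin.tail c) t) +
        G (-c 0 + rademacherSum (Fin.tail c) t)) / 2 := by
  have hadd : ∀ b : ℝ, Continuous fun y => G (b + y) := fun b => by fun_prop
  have h1 : ∫ t in (0 : ℝ)..(1 / 2), G (rademacherSum c t) =
      2⁻¹ * ∫ t in (0 : ℝ)..1, G (c 0 + rademacherSum (Fin.tail c) t) := by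
    have : ∫ t in (0 : ℝ)..(1 / 2), G (rademacherSum c t) =
        ∫ t in (0 : ℝ)..(1 / 2), G (c 0 + rademacherSum (Fin.tail c) (2 * t)) := by
      refine intervalIntegral.integral_congr_ae ?_
      filter_upwards [MeasureTheory.Measure.ae_ne MeasureTheory.volume (1 / 2 : ℝ)] with t ht hmem
      rw [Set.uIoc_of_le (by norm_num)] at hmem
      rw [rademacherSum_succ,
        Rademacher_zero_of_lt_half hmem.1.le (lt_of_le_of_ne hmem.2 ht), one_mul]
    rw [this, intervalIntegral.integral_comp_mul_left
      (fun t => G (c 0 + rademacherSum (Fin.tail c) t)) two_ne_zero]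
    norm_num
  have h2 : ∫ t in (1 / 2 : ℝ)..1, G (rademacherSum c t) =
      2⁻¹ * ∫ t in (0 : ℝ)..1, G (-c 0 + rademacherSum (Fin.tail c) t) := by
    have : ∫ t in (1 / 2 : ℝ)..1, G (rademacherSum c t) =
        ∫ t in (1 / 2 : ℝ)..1, G (-c 0 + rademacherSum (Fin.tail c) (2 * t - 1)) := by
      refine intervalIntegral.integral_congr_ae ?_
      filter_upwards [MeasureTheory.Measure.ae_ne MeasureTheory.volume (1 : ℝ)] with t ht hmem
      rw [Set.uIoc_of_le (by norm_num)] at hmem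
      rw [rademacherSum_succ, rademacherSum_sub_one,
        Rademacher_zero_of_half_le hmem.1.le (lt_of_le_of_ne hmem.2 ht), neg_one_mul]
    rw [this, intervalIntegral.integral_comp_mul_sub
      (fun t => G (-c 0 + rademacherSum (Fin.tail c) t)) two_ne_zero]
    norm_num
  rw [← intervalIntegral.integral_add_adjacent_intervals
    (intervalIntegrable_comp_rademacherSum c hG 0 (1 / 2))
    (intervalIntegrable_comp_rademacherSum c hG (1 / 2) 1), h1, h2,
    intervalIntegral.integral_div, intervalIntegral.integral_add
    (intervalIntegrable_comp_rademacherSum (Fin.tail c) (hadd _) 0 1)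
    (intervalIntegrable_comp_rademacherSum (Fin.tail c) (hadd _) 0 1)]
  ring

theorem integral_rademacherSum_sq : ∀ {n : ℕ} (c : Fin n → ℝ),
    ∫ t in (0 : ℝ)..1, rademacherSum c t ^ 2 = ∑ k, c k ^ 2
  | 0, c => by simp [rademacherSum]
  | n + 1, c => by
    have hG : Continuous fun y : ℝ => y ^ 2 := by fun_prop
    rw [integral_comp_rademacherSum_succ c hG, Fin.sum_univ_succ]
    have : ∀ t, ((c 0 + rademacherSum (Fin.tail c) t) ^ 2 +
        (-c 0 + rademacherSum (Fin.tail c) t) ^ 2) / 2 =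
        c 0 ^ 2 + rademacherSum (Fin.tail c) t ^ 2 := fun t => by ring
    simp only [this]
    rw [intervalIntegral.integral_add intervalIntegrable_const
      (intervalIntegrable_comp_rademacherSum (Fin.tail c) hG 0 1), integral_rademacherSum_sq]
    simp [Fin.tail]

/-- Khintchine's inequality for the fourth moment. -/
theorem integral_rademacherSum_pow_four_le : ∀ {n : ℕ} (c : Fin n → ℝ),
    ∫ t in (0 : ℝ)..1, rademacherSum c t ^ 4 ≤ 3 * (∑ k, c k ^ 2) ^ 2
  | 0, c => by simp [rademacherSum]
  | n + 1, c => by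
    have hG : Continuous fun y : ℝ => y ^ 4 := by fun_prop
    have hG2 : Continuous fun y : ℝ => 6 * c 0 ^ 2 * y ^ 2 := by fun_prop
    have hG3 : Continuous fun y : ℝ => c 0 ^ 4 + 6 * c 0 ^ 2 * y ^ 2 := by fun_prop
    rw [integral_comp_rademacherSum_succ c hG, Fin.sum_univ_succ]
    have : ∀ t, ((c 0 + rademacherSum (Fin.tail c) t) ^ 4 +
        (-c 0 + rademacherSum (Fin.tail c) t) ^ 4) / 2 =
        (c 0 ^ 4 + 6 * c 0 ^ 2 * rademacherSum (Fin.tail c) t ^ 2) +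
          rademacherSum (Fin.tail c) t ^ 4 := fun t => by ring
    simp only [this]
    rw [intervalIntegral.integral_add
      (intervalIntegrable_comp_rademacherSum (Fin.tail c) hG3 0 1)
      (intervalIntegrable_comp_rademacherSum (Fin.tail c) hG 0 1),
      intervalIntegral.integral_add intervalIntegrable_const
      (intervalIntegrable_comp_rademacherSum (Fin.tail c) hG2 0 1),
      intervalIntegral.integral_const_mul, integral_rademacherSum_sq]
    have ih := integral_rademacherSum_pow_four_le (Fin.tail c)
    have hs : 0 ≤ ∑ k, Fin.tail c k ^ 2 := Finset.sum_nonneg fun k _ => sq_nonneg _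
    have e : ∑ k : Fin n, c k.succ ^ 2 = ∑ k, Fin.tail c k ^ 2 := rfl
    rw [e, intervalIntegral.integral_const]
    simp only [sub_zero, one_smul]
    nlinarith [sq_nonneg (c 0 ^ 2)]

/-- Pietsch domination for the linear map `a ↦ ∑ a i • x i` on `ℝ^ι` with the sup norm. -/
theorem exists_pietsch_measure {ι E : Type*} [Fintype ι] [Nonempty ι] [NormedAddCommGroup E]
    [NormedSpace ℝ E] (x : ι → E) (Q : ℝ)
    (H : ∀ (K : ℕ) (f : Fin K → ι → ℝ) (M : ℝ), 0 ≤ M → (∀ i, ∑ k, f k i ^ 2 ≤ M) →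
      ∑ k, ‖∑ i, f k i • x i‖ ^ 2 ≤ Q * M) :
    ∃ μ : ι → ℝ, (∀ i, 0 ≤ μ i) ∧ ∑ i, μ i ≤ 1 ∧
      ∀ a : ι → ℝ, ‖∑ i, a i • x i‖ ^ 2 ≤ Q * ∑ i, μ i * a i ^ 2 := by
  classical
  set v : (ι → ℝ) → ι → ℝ := fun a i => Q * a i ^ 2 - ‖∑ i, a i • x i‖ ^ 2 with hv
  set N : Set (ι → ℝ) := {b | ∀ i, b i < 0} with hN
  have hNo : IsOpen N := by
    simp only [hN, Set.ofPred_forall]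
    exact isOpen_iInter_of_finite fun i => isOpen_lt (continuous_apply i) continuous_const
  have hNc : Convex ℝ N := by
    intro b hb d hd s t hs ht hst i
    have h1 := hb i
    have h2 := hd i
    simp only [Pi.add_apply, Pi.smul_apply, smul_eq_mul]
    rcases hs.eq_or_lt with h | h
    · have : t = 1 := by linarith
      subst this; subst h; linarith
    · nlinarith
  have hdis : Disjoint N (convexHull ℝ (Set.range v)) := by
    rw [Set.disjoint_left]
    intro b hb hbc
    rw [mem_convexHull_iff_exists_fintype] at hbc
    obtain ⟨κ, _, w, z, hw, -, hz, rfl⟩ := hbc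
    choose f hf using hz
    let e := Fintype.equivFin κ
    let g : Fin (Fintype.card κ) → ι → ℝ := fun k i => √(w (e.symm k)) * f (e.symm k) i
    have hg1 : ∀ i, ∑ k, g k i ^ 2 = ∑ k, w k * f k i ^ 2 := fun i => by
      rw [← e.symm.sum_comp]
      exact Finset.sum_congr rfl fun k _ => by
        simp only [g]; rw [mul_pow, Real.sq_sqrt (hw _)]
    have hg2 : ∑ k, ‖∑ i, g k i • x i‖ ^ 2 = ∑ k, w k * ‖∑ i, f k i • x i‖ ^ 2 := by
      rw [← e.symm.sum_comp]
      exact Finset.sum_congr rfl fun k _ => by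
        simp only [g, mul_smul]
        rw [← Finset.smul_sum, norm_smul, mul_pow, Real.norm_eq_abs, sq_abs, Real.sq_sqrt (hw _)]
    obtain ⟨i₀, hi₀⟩ := Finite.exists_max fun i => ∑ k, g k i ^ 2
    have h1 := H _ g _ (Finset.sum_nonneg fun k _ => sq_nonneg (g k i₀)) hi₀
    have h2 := hb i₀
    rw [hg2, hg1] at h1
    have h3 : (∑ k, w k • z k) i₀ =
        Q * ∑ k, w k * f k i₀ ^ 2 - ∑ k, w k * ‖∑ i, f k i • x i‖ ^ 2 := by
      rw [Finset.sum_apply, Finset.mul_sum, ← Finset.sum_sub_distrib]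
      refine Finset.sum_congr rfl fun k _ => ?_
      rw [← hf k]
      simp only [hv, Pi.smul_apply, smul_eq_mul]
      ring
    linarith
  obtain ⟨l, u, hl1, hl2⟩ := geometric_hahn_banach_open hNc hNo (convex_convexHull ℝ _) hdis
  have hu0 : u ≤ 0 := by
    have h0 : (0 : ι → ℝ) ∈ Set.range v := ⟨0, by funext i; simp [hv]⟩
    simpa using hl2 0 (subset_convexHull ℝ _ h0)
  have hl1pos : 0 < l 1 := by
    have := hl1 (-1) (fun i => by simp)
    rw [map_neg] at this
    linarith
  have hu : 0 ≤ u := by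
    by_contra hneg
    push Not at hneg
    have := hl1 ((u / l 1) • (1 : ι → ℝ)) (fun i => by
      simpa using div_neg_of_neg_of_pos hneg hl1pos)
    rw [map_smul, smul_eq_mul, div_mul_cancel₀ _ hl1pos.ne'] at this
    exact lt_irrefl _ this
  have hrep : ∀ b : ι → ℝ, l b = ∑ i, b i * l (Pi.single i 1) := fun b => by
    conv_lhs => rw [pi_eq_sum_univ' b]
    rw [map_sum]
    simp [map_smul]
  have hnn : ∀ i, 0 ≤ l (Pi.single i 1) := by
    intro i
    by_contra hneg
    push Not at hneg
    set q := l (Pi.single i 1)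
    have h := hl1 ((l 1 / q) • Pi.single i (1 : ℝ) - 1) (fun j => by
      have h1 : l 1 / q ≤ 0 := (div_neg_of_pos_of_neg hl1pos hneg).le
      have h2 : (0 : ℝ) ≤ (Pi.single i (1 : ℝ) : ι → ℝ) j := by
        by_cases hij : j = i
        · subst hij; simp
        · simp [hij]
      simp only [Pi.sub_apply, Pi.smul_apply, smul_eq_mul, Pi.one_apply]
      nlinarith)
    rw [map_sub, map_smul, smul_eq_mul, div_mul_cancel₀ _ hneg.ne] at h
    linarith
  have hsum : ∑ i, l (Pi.single i 1) = l 1 := by rw [hrep 1]; simp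
  refine ⟨fun i => l (Pi.single i 1) / l 1, fun i => div_nonneg (hnn i) hl1pos.le, ?_, fun a => ?_⟩
  · rw [← Finset.sum_div, hsum, div_self hl1pos.ne']
  · have h := hl2 (v a) (subset_convexHull ℝ _ ⟨a, rfl⟩)
    have h1 : l (v a) = Q * ∑ i, a i ^ 2 * l (Pi.single i 1) - ‖∑ i, a i • x i‖ ^ 2 * l 1 := by
      rw [hrep, ← hsum, Finset.mul_sum, Finset.mul_sum, ← Finset.sum_sub_distrib]
      exact Finset.sum_congr rfl fun i _ => by simp only [hv]; ring
    have h2 : ∑ i, l (Pi.single i 1) / l 1 * a i ^ 2 =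
        (∑ i, a i ^ 2 * l (Pi.single i 1)) / l 1 := by
      rw [Finset.sum_div]; exact Finset.sum_congr rfl fun i _ => by ring
    rw [h2, ← mul_div_assoc, le_div_iff₀ hl1pos]
    linarith

theorem HasCotype.exists_sum_sq_le {E : Type*} [NormedAddCommGroup E] [NormedSpace ℝ E]
    (hE : HasCotype 2 E) :
    ∃ C > 0, ∀ (n : ℕ) (x : Fin n → E), ∑ k, ‖x k‖ ^ 2 ≤
      C * ∫ t in (0 : ℝ)..1, ‖∑ k : Fin n, Rademacher k.1 t • x k‖ ^ 2 := by
  obtain ⟨-, C, hC, h⟩ := hE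
  refine ⟨C ^ 2, by positivity, fun n x => ?_⟩
  have h1 := h n x
  have hI : 0 ≤ ∫ t in (0 : ℝ)..1, ‖∑ k : Fin n, Rademacher k.1 t • x k‖ ^ 2 :=
    intervalIntegral.integral_nonneg zero_le_one fun t _ => by positivity
  have hS : 0 ≤ ∑ k, ‖x k‖ ^ 2 := by positivity
  simp only [Real.rpow_two] at h1
  rw [← Real.sqrt_eq_rpow, ← Real.sqrt_eq_rpow] at h1
  calc ∑ k, ‖x k‖ ^ 2 = √(∑ k, ‖x k‖ ^ 2) ^ 2 := (Real.sq_sqrt hS).symm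
    _ ≤ _ := pow_le_pow_left₀ (Real.sqrt_nonneg _) h1 2
    _ = _ := by rw [mul_pow, Real.sq_sqrt hI]

section Domination

variable {ι E : Type*} [Fintype ι] [NormedAddCommGroup E] [NormedSpace ℝ E]

/-- The map `a ↦ ∑ a i • x i` has norm at most `w` on `ℝ^ι` with the sup norm. -/
def SupBounded (x : ι → E) (w : ℝ) : Prop :=
  ∀ (a : ι → ℝ) (t : ℝ), (∀ i, |a i| ≤ t) → ‖∑ i, a i • x i‖ ≤ w * t

/-- The map `a ↦ ∑ a i • x i` is dominated by the `L²` norm of a subprobability measure. -/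
def Dominated (x : ι → E) (Q : ℝ) : Prop :=
  ∃ μ : ι → ℝ, (∀ i, 0 ≤ μ i) ∧ ∑ i, μ i ≤ 1 ∧
    ∀ a : ι → ℝ, ‖∑ i, a i • x i‖ ^ 2 ≤ Q * ∑ i, μ i * a i ^ 2

theorem Dominated.mono {x : ι → E} {Q R : ℝ} (h : Dominated x Q) (hQR : Q ≤ R) :
    Dominated x R := by
  obtain ⟨μ, h0, h1, h2⟩ := h
  refine ⟨μ, h0, h1, fun a => (h2 a).trans ?_⟩
  exact mul_le_mul_of_nonneg_right hQR
    (Finset.sum_nonneg fun i _ => mul_nonneg (h0 i) (sq_nonneg _))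

/-- Truncation at height `√τ`: a sup norm bound and an `L²` bound give an `L⁴` bound. -/
theorem SupBounded.norm_sq_le {x : ι → E} {w : ℝ} (hw : SupBounded x w) {Q : ℝ} (hQ : 0 ≤ Q)
    {μ : ι → ℝ} (hμ : ∀ i, 0 ≤ μ i)
    (hdom : ∀ a : ι → ℝ, ‖∑ i, a i • x i‖ ^ 2 ≤ Q * ∑ i, μ i * a i ^ 2)
    {τ : ℝ} (hτ : 0 < τ) (g : ι → ℝ) :
    ‖∑ i, g i • x i‖ ^ 2 ≤ 2 * w ^ 2 * τ + 2 * Q / τ * ∑ i, μ i * g i ^ 4 := by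
  classical
  let g₁ : ι → ℝ := fun i => if g i ^ 2 ≤ τ then g i else 0
  let g₂ : ι → ℝ := fun i => if g i ^ 2 ≤ τ then 0 else g i
  have hg : ∑ i, g i • x i = ∑ i, g₁ i • x i + ∑ i, g₂ i • x i := by
    rw [← Finset.sum_add_distrib]
    refine Finset.sum_congr rfl fun i _ => ?_
    by_cases h : g i ^ 2 ≤ τ <;> simp [g₁, g₂, h]
  have h₁ : ‖∑ i, g₁ i • x i‖ ^ 2 ≤ w ^ 2 * τ := by
    have := hw g₁ (√τ) fun i => by
      by_cases h : g i ^ 2 ≤ τ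
      · simpa [g₁, h] using Real.abs_le_sqrt h
      · simp [g₁, h]
    calc _ ≤ (w * √τ) ^ 2 := pow_le_pow_left₀ (norm_nonneg _) this 2
      _ = _ := by rw [mul_pow, Real.sq_sqrt hτ.le]
  have h₂ : ‖∑ i, g₂ i • x i‖ ^ 2 ≤ Q / τ * ∑ i, μ i * g i ^ 4 := by
    refine (hdom g₂).trans ?_
    rw [div_mul_eq_mul_div, mul_div_assoc]
    refine mul_le_mul_of_nonneg_left ?_ hQ
    rw [Finset.sum_div]
    refine Finset.sum_le_sum fun i _ => ?_
    rw [mul_div_assoc]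
    refine mul_le_mul_of_nonneg_left ?_ (hμ i)
    rw [le_div_iff₀ hτ]
    by_cases h : g i ^ 2 ≤ τ
    · have h0 : g₂ i = 0 := if_pos h
      rw [h0, zero_pow two_ne_zero, zero_mul]; positivity
    · simp only [g₂, h, if_false]
      push Not at h
      nlinarith [sq_nonneg (g i)]
  have h₃ : ‖∑ i, g i • x i‖ ≤ ‖∑ i, g₁ i • x i‖ + ‖∑ i, g₂ i • x i‖ := by
    rw [hg]; exact norm_add_le _ _
  have h₄ : 2 * Q / τ = 2 * (Q / τ) := by ring
  rw [h₄]
  nlinarith [sq_nonneg (‖∑ i, g₁ i • x i‖ - ‖∑ i, g₂ i • x i‖), norm_nonneg (∑ i, g i • x i)]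

/-- One step of Maurey's extrapolation in a space satisfying a cotype 2 inequality. -/
theorem Dominated.improve [Nonempty ι] {C : ℝ} (hC : 0 < C)
    (hcot : ∀ (n : ℕ) (z : Fin n → E), ∑ k, ‖z k‖ ^ 2 ≤
      C * ∫ t in (0 : ℝ)..1, ‖∑ k : Fin n, Rademacher k.1 t • z k‖ ^ 2)
    {x : ι → E} {w : ℝ} (hw0 : 0 < w) (hw : SupBounded x w) {Q : ℝ} (hQ : 0 < Q)
    (h : Dominated x Q) : Dominated x (8 * C * w * √Q) := by
  obtain ⟨μ, hμ, hμ1, hdom⟩ := h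
  refine exists_pietsch_measure x _ fun K f M hM hfM => ?_
  rcases hM.eq_or_lt with rfl | hM
  · have hf : ∀ k i, f k i = 0 := fun k i => by
      have := (Finset.single_le_sum (f := fun k => f k i ^ 2) (fun k _ => sq_nonneg _)
        (Finset.mem_univ k)).trans (hfM i)
      exact pow_eq_zero_iff two_ne_zero |>.1 (le_antisymm this (sq_nonneg _))
    simp [hf]
  have hsQ : 0 < √Q := Real.sqrt_pos.2 hQ
  set τ := √Q * M / w with hτdef
  have hτ : 0 < τ := by positivity
  have hsum : ∀ t, ∑ k : Fin K, Rademacher k.1 t • ∑ i, f k i • x i =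
      ∑ i, rademacherSum (fun k => f k i) t • x i := fun t => by
    simp only [Finset.smul_sum, rademacherSum, Finset.sum_smul, mul_smul]
    exact Finset.sum_comm
  have hint : ∀ i, IntervalIntegrable (fun t => μ i * rademacherSum (fun k => f k i) t ^ 4)
      MeasureTheory.volume 0 1 := fun i =>
    intervalIntegrable_comp_rademacherSum (fun k => f k i) (G := fun y => μ i * y ^ 4)
      (by fun_prop) 0 1
  have hint2 : IntervalIntegrable
      (fun t => ∑ i, μ i * rademacherSum (fun k => f k i) t ^ 4) MeasureTheory.volume 0 1 := by
    have := IntervalIntegrable.sum Finset.univ fun i _ => hint i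
    simpa only [Finset.sum_fn] using this
  have hI : ∫ t in (0 : ℝ)..1, ‖∑ k : Fin K, Rademacher k.1 t • ∑ i, f k i • x i‖ ^ 2 ≤
      2 * w ^ 2 * τ + 2 * Q / τ * (3 * M ^ 2) := by
    calc _ ≤ ∫ t in (0 : ℝ)..1, (2 * w ^ 2 * τ + 2 * Q / τ *
          ∑ i, μ i * rademacherSum (fun k => f k i) t ^ 4) := by
          rw [intervalIntegral.integral_of_le zero_le_one,
            intervalIntegral.integral_of_le zero_le_one]
          refine MeasureTheory.integral_mono_of_nonneg
            (Filter.Eventually.of_forall fun t => by positivity) ?_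
            (Filter.Eventually.of_forall fun t => ?_)
          · rw [← MeasureTheory.IntegrableOn, ← intervalIntegrable_iff_integrableOn_Ioc_of_le
              zero_le_one]
            exact intervalIntegrable_const.add (hint2.const_mul _)
          · simp only [hsum]
            exact hw.norm_sq_le hQ.le hμ hdom hτ _
      _ = 2 * w ^ 2 * τ + 2 * Q / τ *
          ∑ i, μ i * ∫ t in (0 : ℝ)..1, rademacherSum (fun k => f k i) t ^ 4 := by
          rw [intervalIntegral.integral_add intervalIntegrable_const (hint2.const_mul _),
            intervalIntegral.integral_const_mul (2 * Q / τ),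
            intervalIntegral.integral_finsetSum fun i _ => hint i]
          simp only [intervalIntegral.integral_const_mul]
          simp
      _ ≤ _ := by
          refine add_le_add_right (mul_le_mul_of_nonneg_left ?_ (by positivity)) _
          calc _ ≤ ∑ i, μ i * (3 * M ^ 2) := by
                refine Finset.sum_le_sum fun i _ => mul_le_mul_of_nonneg_left ?_ (hμ i)
                refine (integral_rademacherSum_pow_four_le _).trans ?_
                have h0 : 0 ≤ ∑ k, f k i ^ 2 := Finset.sum_nonneg fun k _ => sq_nonneg _
                exact mul_le_mul_of_nonneg_left (pow_le_pow_left₀ h0 (hfM i) 2) (by norm_num)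
            _ = (∑ i, μ i) * (3 * M ^ 2) := by rw [Finset.sum_mul]
            _ ≤ 1 * (3 * M ^ 2) := mul_le_mul_of_nonneg_right hμ1 (by positivity)
            _ = _ := one_mul _
  refine (hcot K _).trans ((mul_le_mul_of_nonneg_left hI hC.le).trans_eq ?_)
  have hQ2 : Q = √Q ^ 2 := (Real.sq_sqrt hQ.le).symm
  rw [hτdef]
  set q := √Q
  rw [hQ2]
  field_simp
  ring

theorem exists_dominated (x : ι → E) : ∃ Q > 0, Dominated x Q := by
  classical
  have hc : 0 < (Fintype.card ι : ℝ) + 1 := by positivity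
  set S := ∑ i, ‖x i‖ ^ 2 with hS
  have hS0 : 0 ≤ S := by positivity
  refine ⟨(S + 1) * (Fintype.card ι + 1), by positivity,
    fun _ => 1 / ((Fintype.card ι : ℝ) + 1), fun _ => by positivity, ?_, fun a => ?_⟩
  · rw [Finset.sum_const, Finset.card_univ, nsmul_eq_mul, mul_one_div, div_le_one hc]
    linarith
  · have h1 : ‖∑ i, a i • x i‖ ≤ ∑ i, |a i| * ‖x i‖ :=
      (norm_sum_le _ _).trans_eq (Finset.sum_congr rfl fun i _ => by
        rw [norm_smul, Real.norm_eq_abs])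
    have h2 : (∑ i, |a i| * ‖x i‖) ^ 2 ≤ (∑ i, |a i| ^ 2) * S :=
      Finset.sum_mul_sq_le_sq_mul_sq _ _ _
    simp only [sq_abs] at h2
    have h3 : 0 ≤ ∑ i, a i ^ 2 := by positivity
    calc _ ≤ (∑ i, |a i| * ‖x i‖) ^ 2 := pow_le_pow_left₀ (norm_nonneg _) h1 2
      _ ≤ (∑ i, a i ^ 2) * S := h2
      _ ≤ (∑ i, a i ^ 2) * (S + 1) := mul_le_mul_of_nonneg_left (by linarith) h3
      _ = _ := by
        rw [← Finset.mul_sum]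
        field_simp

/-- Maurey: operators from `ℓ_∞^n` into a cotype 2 space are 2-dominated, uniformly in `n`. -/
theorem SupBounded.dominated [Nonempty ι] {C : ℝ} (hC : 0 < C)
    (hcot : ∀ (n : ℕ) (z : Fin n → E), ∑ k, ‖z k‖ ^ 2 ≤
      C * ∫ t in (0 : ℝ)..1, ‖∑ k : Fin n, Rademacher k.1 t • z k‖ ^ 2)
    {x : ι → E} {w : ℝ} (hw0 : 0 < w) (hw : SupBounded x w) : Dominated x ((16 * C * w) ^ 2) := by
  by_contra hnot
  set S : Set ℝ := {Q | 0 < Q ∧ Dominated x Q} with hSdef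
  have hne : S.Nonempty := by
    obtain ⟨Q, hQ, h⟩ := exists_dominated x
    exact ⟨Q, hQ, h⟩
  have hlow : ∀ Q ∈ S, (16 * C * w) ^ 2 ≤ Q := fun Q hQ => by
    by_contra hlt
    exact hnot (hQ.2.mono (not_le.1 hlt).le)
  have hbdd : BddBelow S := ⟨_, hlow⟩
  have hpos : 0 < sInf S := lt_of_lt_of_le (by positivity) (le_csInf hne hlow)
  obtain ⟨Q, hQ, hlt⟩ := exists_lt_of_csInf_lt hne (show sInf S < 2 * sInf S by linarith)
  have hsq : 16 * C * w ≤ √Q := Real.le_sqrt_of_sq_le (hlow Q hQ)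
  have hle : 8 * C * w * √Q ≤ Q / 2 := by
    nlinarith [Real.sq_sqrt hQ.1.le, Real.sqrt_nonneg Q]
  have hmem : Q / 2 ∈ S := ⟨half_pos hQ.1, (hQ.2.improve hC hcot hw0 hw hQ.1).mono hle⟩
  linarith [csInf_le hbdd hmem]

theorem supBounded_of_dual [Nonempty ι] {x : ι → E} {w : ℝ}
    (hw : ∀ φ : E →L[ℝ] ℝ, ‖φ‖ ≤ 1 → ∑ i, |φ (x i)| ≤ w) : SupBounded x w := by
  intro a t ht
  obtain ⟨φ, hφ, hφx⟩ := exists_dual_vector'' ℝ (∑ i, a i • x i)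
  have hφx' : φ (∑ i, a i • x i) = ‖∑ i, a i • x i‖ := hφx
  rw [← hφx', map_sum]
  calc ∑ i, φ (a i • x i) ≤ ∑ i, |φ (x i)| * t := by
        refine Finset.sum_le_sum fun i _ => (le_abs_self _).trans ?_
        rw [map_smul, smul_eq_mul, abs_mul, mul_comm]
        exact mul_le_mul_of_nonneg_left (ht i) (abs_nonneg _)
    _ = (∑ i, |φ (x i)|) * t := by rw [Finset.sum_mul]
    _ ≤ w * t := by
        obtain ⟨i⟩ := ‹Nonempty ι›
        exact mul_le_mul_of_nonneg_right (hw φ hφ) ((abs_nonneg _).trans (ht i))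

/-- A weakly 1-summable family in a cotype 2 space, divided by the square roots of suitable
positive weights of total mass at most 1, is weakly 2-summable. -/
theorem exists_weights [Nonempty ι] {C : ℝ} (hC : 0 < C)
    (hcot : ∀ (n : ℕ) (z : Fin n → E), ∑ k, ‖z k‖ ^ 2 ≤
      C * ∫ t in (0 : ℝ)..1, ‖∑ k : Fin n, Rademacher k.1 t • z k‖ ^ 2)
    {x : ι → E} {w : ℝ} (hw0 : 0 < w)
    (hw : ∀ φ : E →L[ℝ] ℝ, ‖φ‖ ≤ 1 → ∑ i, |φ (x i)| ≤ w) :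
    ∃ μ : ι → ℝ, (∀ i, 0 < μ i) ∧ ∑ i, μ i ≤ 1 ∧ ∀ φ : E →L[ℝ] ℝ, ‖φ‖ ≤ 1 →
      ∑ i, |φ (x i)| ^ 2 / μ i ≤ 2 * (16 * C * w) ^ 2 := by
  obtain ⟨ν, hν, hν1, hdom⟩ := (supBounded_of_dual hw).dominated hC hcot hw0
  have hc : 0 < (Fintype.card ι : ℝ) := by exact_mod_cast Fintype.card_pos
  have hpos : ∀ i, 0 < (ν i + 1 / (Fintype.card ι : ℝ)) / 2 := fun i => by
    have := hν i; positivity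
  refine ⟨fun i => (ν i + 1 / (Fintype.card ι : ℝ)) / 2, hpos, ?_, fun φ hφ => ?_⟩
  · rw [← Finset.sum_div, Finset.sum_add_distrib, Finset.sum_const, Finset.card_univ,
      nsmul_eq_mul, mul_one_div_cancel hc.ne']
    linarith
  · set μ : ι → ℝ := fun i => (ν i + 1 / (Fintype.card ι : ℝ)) / 2 with hμ
    set X := ∑ i, |φ (x i)| ^ 2 / μ i with hX
    have hX0 : 0 ≤ X := Finset.sum_nonneg fun i _ => div_nonneg (sq_nonneg _) (hpos i).le
    have hφs : φ (∑ i, (φ (x i) / μ i) • x i) = X := by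
      rw [map_sum]
      refine Finset.sum_congr rfl fun i _ => ?_
      rw [map_smul, smul_eq_mul, sq_abs]; ring
    have h1 : X ≤ ‖∑ i, (φ (x i) / μ i) • x i‖ := by
      rw [← hφs]
      exact (le_abs_self _).trans ((φ.le_opNorm _).trans
        (mul_le_of_le_one_left (norm_nonneg _) hφ))
    have h2 : ∑ i, ν i * (φ (x i) / μ i) ^ 2 ≤ 2 * X := by
      rw [hX, Finset.mul_sum]
      refine Finset.sum_le_sum fun i _ => ?_
      have hμi : 0 < μ i := hpos i
      have h3 : ν i ≤ 2 * μ i := by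
        have : 0 ≤ 1 / (Fintype.card ι : ℝ) := by positivity
        simp only [hμ]; linarith
      rw [sq_abs]
      calc ν i * (φ (x i) / μ i) ^ 2 ≤ 2 * μ i * (φ (x i) / μ i) ^ 2 :=
            mul_le_mul_of_nonneg_right h3 (sq_nonneg _)
        _ = _ := by field_simp
    have h4 : X ^ 2 ≤ (16 * C * w) ^ 2 * (2 * X) :=
      (pow_le_pow_left₀ hX0 h1 2).trans ((hdom _).trans
        (mul_le_mul_of_nonneg_left h2 (sq_nonneg _)))
    rcases hX0.eq_or_lt with h0 | h0
    · rw [← h0]; positivity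
    · nlinarith

end Domination

section WeakNorm

variable {E : Type*} [NormedAddCommGroup E] [NormedSpace ℝ E]

theorem weakNorm_nonneg (p : ℝ) (x : ℕ → E) : 0 ≤ weakNorm p x :=
  Real.iSup_nonneg fun _ => Real.rpow_nonneg
    (tsum_nonneg fun _ => Real.rpow_nonneg (abs_nonneg _) _) _

theorem WeaklySummable.summable_abs {x : ℕ → E} (hx : WeaklySummable 1 x) (φ : E →L[ℝ] ℝ) :
    Summable fun j => |φ (x j)| := by
  simpa only [Real.rpow_one] using hx φ

theorem WeaklySummable.exists_sum_abs_le {x : ℕ → E} (hx : WeaklySummable 1 x) :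
    ∃ B, ∀ φ : E →L[ℝ] ℝ, ‖φ‖ ≤ 1 → ∀ N, ∑ j ∈ Finset.range N, |φ (x j)| ≤ B := by
  let g : ℕ × (ℕ → SignType) → (E →L[ℝ] ℝ) →L[ℝ] ℝ := fun q =>
    ∑ j ∈ Finset.range q.1, ((q.2 j : SignType) : ℝ) • ContinuousLinearMap.apply ℝ ℝ (x j)
  have hg : ∀ q φ, g q φ = ∑ j ∈ Finset.range q.1, ((q.2 j : SignType) : ℝ) * φ (x j) := by
    intro q φ
    simp [g]
  have hsign : ∀ e : SignType, |(e : ℝ)| ≤ 1 := by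
    intro e; cases e <;> simp
  obtain ⟨B, hB⟩ := banach_steinhaus (g := g) fun φ => by
    refine ⟨∑' j, |φ (x j)|, fun q => ?_⟩
    rw [hg, Real.norm_eq_abs]
    refine (Finset.abs_sum_le_sum_abs _ _).trans (le_trans (Finset.sum_le_sum fun j _ => ?_)
      ((hx.summable_abs φ).sum_le_tsum (Finset.range q.1) fun j _ => abs_nonneg _))
    rw [abs_mul]
    exact mul_le_of_le_one_left (abs_nonneg _) (hsign _)
  refine ⟨B, fun φ hφ N => ?_⟩
  have h1 : ∑ j ∈ Finset.range N, |φ (x j)| = g (N, fun j => SignType.sign (φ (x j))) φ := by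
    rw [hg]
    exact Finset.sum_congr rfl fun j _ => (sign_mul_self (φ (x j))).symm
  have hB0 : 0 ≤ B := (norm_nonneg _).trans (hB (0, fun _ => 0))
  rw [h1]
  calc _ ≤ ‖g _ φ‖ := le_abs_self _
    _ ≤ ‖g _‖ * ‖φ‖ := (g _).le_opNorm φ
    _ ≤ B * 1 := mul_le_mul (hB _) hφ (norm_nonneg _) hB0
    _ = B := mul_one B

theorem WeaklySummable.sum_abs_le_weakNorm {x : ℕ → E} (hx : WeaklySummable 1 x)
    {φ : E →L[ℝ] ℝ} (hφ : ‖φ‖ ≤ 1) (N : ℕ) :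
    ∑ j ∈ Finset.range N, |φ (x j)| ≤ weakNorm 1 x := by
  obtain ⟨B, hB⟩ := hx.exists_sum_abs_le
  refine ((hx.summable_abs φ).sum_le_tsum _ fun j _ => abs_nonneg _).trans ?_
  have hbdd : BddAbove (Set.range fun φ : {φ : E →L[ℝ] ℝ // ‖φ‖ ≤ 1} =>
      (∑' j, |φ.1 (x j)| ^ (1 : ℝ)) ^ (1 / (1 : ℝ))) := by
    refine ⟨B, ?_⟩
    rintro _ ⟨ψ, rfl⟩
    simp only [Real.rpow_one, one_div_one]
    exact Real.tsum_le_of_sum_range_le (fun _ => abs_nonneg _) (hB ψ.1 ψ.2)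
  simpa only [weakNorm, Real.rpow_one, one_div_one] using le_ciSup hbdd ⟨φ, hφ⟩

theorem WeaklySummable.eq_zero_of_weakNorm_le_zero {x : ℕ → E} (hx : WeaklySummable 1 x)
    (h0 : weakNorm 1 x ≤ 0) (j : ℕ) : x j = 0 := by
  obtain ⟨φ, hφ, hφx⟩ := exists_dual_vector'' ℝ (x j)
  have hφx' : φ (x j) = ‖x j‖ := hφx
  have h1 := (Finset.single_le_sum (f := fun j => |φ (x j)|) (fun _ _ => abs_nonneg _)
    (Finset.self_mem_range_succ j)).trans (hx.sum_abs_le_weakNorm hφ (j + 1))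
  simp only [hφx', abs_norm] at h1
  exact norm_le_zero_iff.1 (h1.trans h0)

theorem HasCotype.exists_weights_range (hE : HasCotype 2 E) :
    ∃ K ≥ 1, ∀ x : ℕ → E, WeaklySummable 1 x → 0 < weakNorm 1 x → ∀ N : ℕ,
      ∃ μ : ℕ → ℝ, (∀ j, 0 < μ j) ∧ ∑ j ∈ Finset.range (N + 1), μ j ≤ 1 ∧
        ∀ φ : E →L[ℝ] ℝ, ‖φ‖ ≤ 1 →
          ∑ j ∈ Finset.range (N + 1), |φ (x j)| ^ 2 / μ j ≤ (K * weakNorm 1 x) ^ 2 := by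
  obtain ⟨C, hC, hcot⟩ := hE.exists_sum_sq_le
  refine ⟨32 * C + 1, by linarith, fun x hx hpos N => ?_⟩
  obtain ⟨μ, hμ, hμ1, h⟩ := exists_weights (ι := Fin (N + 1)) hC hcot (x := fun i => x i) hpos
    fun φ hφ => by
      rw [Fin.sum_univ_eq_sum_range (fun j => |φ (x j)|)]
      exact hx.sum_abs_le_weakNorm hφ _
  let ν : ℕ → ℝ := fun j => if h : j < N + 1 then μ ⟨j, h⟩ else 1
  have hν : ∀ i : Fin (N + 1), ν i = μ i := fun i => dif_pos i.2
  refine ⟨ν, fun j => ?_, ?_, fun φ hφ => ?_⟩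
  · by_cases hj : j < N + 1
    · rw [hν ⟨j, hj⟩]; exact hμ _
    · rw [show ν j = 1 from dif_neg hj]; exact one_pos
  · rw [← Fin.sum_univ_eq_sum_range]
    simpa only [hν] using hμ1
  · rw [← Fin.sum_univ_eq_sum_range (fun j => |φ (x j)| ^ 2 / ν j)]
    simp only [hν]
    refine (h φ hφ).trans ?_
    have hC2 : 2 * (16 * C) ^ 2 ≤ (32 * C + 1) ^ 2 := by nlinarith
    rw [mul_pow, mul_pow _ (weakNorm 1 x), ← mul_assoc]
    exact mul_le_mul_of_nonneg_right hC2 (sq_nonneg _)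

/-- Dividing the first `N` terms of `x` by the powers `μ j ^ (1 - 1 / r)`. -/
def reweight (r : ℝ) (μ : ℕ → ℝ) (N : ℕ) (x : ℕ → E) (j : ℕ) : E :=
  if j < N then (μ j ^ (1 - 1 / r))⁻¹ • x j else 0

variable {r : ℝ} {μ : ℕ → ℝ} {N : ℕ} {x : ℕ → E}

theorem abs_apply_reweight_eq_zero (hr : 1 ≤ r) (φ : E →L[ℝ] ℝ) {j : ℕ}
    (hj : j ∉ Finset.range N) : |φ (reweight r μ N x j)| ^ r = 0 := by
  rw [Finset.mem_range] at hj
  rw [reweight, if_neg hj, map_zero, abs_zero, Real.zero_rpow (by linarith)]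

theorem weaklySummable_reweight (hr : 1 ≤ r) : WeaklySummable r (reweight r μ N x) :=
  fun φ => summable_of_ne_finset_zero fun _ hj => abs_apply_reweight_eq_zero hr φ hj

theorem weakNorm_reweight_le (hr : 1 ≤ r) (hr2 : r ≤ 2) (hμ : ∀ j, 0 < μ j) {P : ℝ} (hP : 0 < P)
    (h₁ : ∀ φ : E →L[ℝ] ℝ, ‖φ‖ ≤ 1 → ∑ j ∈ Finset.range N, |φ (x j)| ≤ P)
    (h₂ : ∀ φ : E →L[ℝ] ℝ, ‖φ‖ ≤ 1 → ∑ j ∈ Finset.range N, |φ (x j)| ^ 2 / μ j ≤ P ^ 2) :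
    weakNorm r (reweight r μ N x) ≤ P := by
  have hr0 : 0 < r := by linarith
  have : Nonempty {φ : E →L[ℝ] ℝ // ‖φ‖ ≤ 1} := ⟨⟨0, by simp⟩⟩
  refine ciSup_le fun ⟨φ, hφ⟩ => ?_
  rw [tsum_eq_sum fun _ hj => abs_apply_reweight_eq_zero hr φ hj]
  have hterm : ∀ j ∈ Finset.range N, |φ (reweight r μ N x j)| ^ r ≤
      P ^ r * ((2 - r) * (|φ (x j)| / P) + (r - 1) * (|φ (x j)| ^ 2 / μ j / P ^ 2)) := by
    intro j hj
    rw [Finset.mem_range] at hj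
    have hb : 0 ≤ |φ (x j)| := abs_nonneg _
    have hμj := hμ j
    have hpow : 0 < μ j ^ (1 - 1 / r) := Real.rpow_pos_of_pos hμj _
    rw [reweight, if_pos hj, map_smul, smul_eq_mul, abs_mul, abs_inv, abs_of_pos hpow]
    set b := |φ (x j)|
    have hbP : 0 ≤ b / P := div_nonneg hb hP.le
    have key : ((μ j ^ (1 - 1 / r))⁻¹ * b) ^ r =
        P ^ r * ((b / P) ^ (2 - r) * (b ^ 2 / μ j / P ^ 2) ^ (r - 1)) := by
      have e1 : b ^ 2 / μ j / P ^ 2 = (b / P) ^ (2 : ℝ) * (μ j)⁻¹ := by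
        rw [Real.rpow_two]; field_simp
      have e2 : b = P * (b / P) := by field_simp
      rw [e1, Real.mul_rpow (Real.rpow_nonneg hbP _) (inv_nonneg.2 hμj.le), ← Real.rpow_mul hbP,
        ← mul_assoc ((b / P) ^ (2 - r)), ← Real.rpow_add_of_nonneg hbP (by linarith) (by linarith),
        show 2 - r + 2 * (r - 1) = r by ring, Real.mul_rpow (inv_nonneg.2 hpow.le) hb,
        ← mul_assoc, ← Real.mul_rpow hP.le hbP, ← e2, Real.inv_rpow hpow.le,
        ← Real.rpow_mul hμj.le, Real.inv_rpow hμj.le, mul_comm,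
        show (1 - 1 / r) * r = r - 1 by field_simp]
    rw [key]
    refine mul_le_mul_of_nonneg_left ?_ (Real.rpow_nonneg hP.le _)
    exact Real.geom_mean_le_arith_mean2_weighted (by linarith) (by linarith) hbP (by positivity)
      (by ring)
  have hsum : ∑ j ∈ Finset.range N, |φ (reweight r μ N x j)| ^ r ≤ P ^ r := by
    refine (Finset.sum_le_sum hterm).trans ?_
    rw [← Finset.mul_sum, Finset.sum_add_distrib, ← Finset.mul_sum, ← Finset.mul_sum,
      ← Finset.sum_div, ← Finset.sum_div]
    refine mul_le_of_le_one_right (Real.rpow_nonneg hP.le _) ?_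
    have a1 := (div_le_one hP).2 (h₁ φ hφ)
    have a2 := (div_le_one (by positivity : 0 < P ^ 2)).2 (h₂ φ hφ)
    nlinarith
  calc _ ≤ (P ^ r) ^ (1 / r) := Real.rpow_le_rpow
        (Finset.sum_nonneg fun _ _ => Real.rpow_nonneg (abs_nonneg _) _) hsum (by positivity)
    _ = P := by rw [← Real.rpow_mul hP.le, mul_one_div_cancel hr0.ne', Real.rpow_one]

end WeakNorm

/-- Hölder's inequality for sums bounded by one, with a smaller exponent on the left. -/
theorem sum_rpow_mul_rpow_le_one {κ : Type*} (J : Finset κ) {M B : κ → ℝ} {a s β : ℝ}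
    (ha : 0 < a) (hβ : 0 ≤ β) (hs : 0 < s) (h : 1 / s ≤ 1 / a + β) (hM : ∀ j, 0 ≤ M j)
    (hB : ∀ j, 0 ≤ B j) (hM1 : ∑ j ∈ J, M j ≤ 1) (hB1 : ∑ j ∈ J, B j ^ a ≤ 1) :
    ∑ j ∈ J, (M j ^ β * B j) ^ s ≤ 1 := by
  have hd : 0 < 1 / a + β := by positivity
  set t := 1 / (1 / a + β) with htdef
  have ht : 0 < t := by positivity
  have hts : t ≤ s := by
    rw [htdef, one_div_le hd hs]; exact h
  have hexp : β * t + t / a = 1 := by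
    rw [htdef]; field_simp; ring
  have hterm : ∀ j ∈ J, (M j ^ β * B j) ^ s ≤ β * t * M j + t / a * B j ^ a := by
    intro j hj
    have hMj : M j ≤ 1 := (Finset.single_le_sum (fun j _ => hM j) hj).trans hM1
    have hBj : B j ^ a ≤ 1 := (Finset.single_le_sum (f := fun j => B j ^ a)
      (fun j _ => Real.rpow_nonneg (hB j) a) hj).trans hB1
    have hBj' : B j ≤ 1 := by
      by_contra hlt
      exact absurd hBj (not_le.2 (Real.one_lt_rpow (not_le.1 hlt) ha))
    have h0 : 0 ≤ M j ^ β := Real.rpow_nonneg (hM j) _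
    have hle : M j ^ β * B j ≤ 1 := mul_le_one₀ (Real.rpow_le_one (hM j) hMj hβ) (hB j) hBj'
    calc (M j ^ β * B j) ^ s ≤ (M j ^ β * B j) ^ t :=
          Real.rpow_le_rpow_of_exponent_ge' (mul_nonneg h0 (hB j)) hle ht.le hts
      _ = M j ^ (β * t) * (B j ^ a) ^ (t / a) := by
          rw [Real.mul_rpow h0 (hB j), ← Real.rpow_mul (hM j), ← Real.rpow_mul (hB j),
            mul_div_cancel₀ _ ha.ne']
      _ ≤ _ := Real.geom_mean_le_arith_mean2_weighted (by positivity) (by positivity) (hM j)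
          (Real.rpow_nonneg (hB j) a) hexp
  refine (Finset.sum_le_sum hterm).trans ?_
  rw [Finset.sum_add_distrib, ← Finset.mul_sum, ← Finset.mul_sum]
  have h1 : 0 ≤ β * t := by positivity
  have h2 : 0 ≤ t / a := by positivity
  nlinarith

/-- if each `E_i` has cotype `2`, `1 ≤ r ≤ 2`, `r ≤ a < ∞`, `1 ≤ s < ∞` and
`1/r − 1/a ≤ 1 − 1/s`, then every multiple `(a,r)`-summing `m`-linear operator is multiple
`(s,1)`-summing. -/
theorem stmt5 {m : ℕ} (hm : 1 ≤ m) (E : Fin m → Type*) [∀ i, NormedAddCommGroup (E i)]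
    [∀ i, NormedSpace ℝ (E i)] [∀ i, CompleteSpace (E i)]
    (F : Type*) [NormedAddCommGroup F] [NormedSpace ℝ F] [CompleteSpace F]
    (hE : ∀ i, ¬ FiniteDimensional ℝ (E i)) (hF : ¬ FiniteDimensional ℝ F)
    (hcot : ∀ i, HasCotype 2 (E i))
    (r a s : ℝ) (hr1 : 1 ≤ r) (hr2 : r ≤ 2) (hra : r ≤ a) (hs : 1 ≤ s)
    (h : 1 / r - 1 / a ≤ 1 - 1 / s)
    (T : ContinuousMultilinearMap ℝ E F) (hT : MultipleSumming a r T) :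
    MultipleSumming s 1 T := by
  have hr0 : 0 < r := by linarith
  have ha : 0 < a := by linarith
  have hs0 : 0 < s := by linarith
  have hβ : 0 ≤ 1 - 1 / r := by
    rw [sub_nonneg, div_le_one hr0]; exact hr1
  obtain ⟨C, hC, hT⟩ := hT
  choose K hK hw using fun i => (hcot i).exists_weights_range
  have hKpos : 0 < ∏ i, K i := Finset.prod_pos fun i _ => by linarith [hK i]
  refine ⟨C * ∏ i, K i, by positivity, fun x hx => ?_⟩
  by_cases hpos : ∀ i, 0 < weakNorm 1 (x i)
  · set D := C * ∏ i, K i * weakNorm 1 (x i) with hD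
    have hP : ∀ i, 0 < K i * weakNorm 1 (x i) := fun i =>
      mul_pos (by linarith [hK i]) (hpos i)
    have hD0 : 0 < D := mul_pos hC (Finset.prod_pos fun i _ => hP i)
    have hbox : ∀ N : ℕ, ∑ j ∈ Fintype.piFinset fun _ : Fin m => Finset.range (N + 1),
        ‖T fun i => x i (j i)‖ ^ s ≤ D ^ s := by
      intro N
      choose μ hμ hμ1 hμ2 using fun i => hw i (x i) (hx i) (hpos i) N
      set y : (i : Fin m) → ℕ → E i := fun i => reweight r (μ i) (N + 1) (x i) with hy
      obtain ⟨hsum, hle⟩ := hT y fun i => weaklySummable_reweight hr1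
      have hyw : C * ∏ i, weakNorm r (y i) ≤ D := by
        refine mul_le_mul_of_nonneg_left (Finset.prod_le_prod (fun i _ => weakNorm_nonneg _ _)
          fun i _ => ?_) hC.le
        refine weakNorm_reweight_le hr1 hr2 (hμ i) (hP i) (fun φ hφ => ?_) (hμ2 i)
        exact ((hx i).sum_abs_le_weakNorm hφ _).trans
          (le_mul_of_one_le_left (hpos i).le (hK i))
      have hB1 : ∑ j ∈ Fintype.piFinset fun _ : Fin m => Finset.range (N + 1),
          (‖T fun i => y i (j i)‖ / D) ^ a ≤ 1 := by
        have h0 : ∀ j : Fin m → ℕ, 0 ≤ ‖T fun i => y i (j i)‖ ^ a := fun j =>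
          Real.rpow_nonneg (norm_nonneg _) _
        have h1 : ∑' j : Fin m → ℕ, ‖T fun i => y i (j i)‖ ^ a ≤ D ^ a := by
          have := Real.rpow_le_rpow (Real.rpow_nonneg (tsum_nonneg h0) _) (hle.trans hyw) ha.le
          rwa [← Real.rpow_mul (tsum_nonneg h0), one_div_mul_cancel ha.ne', Real.rpow_one] at this
        simp only [Real.div_rpow (norm_nonneg _) hD0.le]
        rw [← Finset.sum_div, div_le_one (Real.rpow_pos_of_pos hD0 _)]
        exact (hsum.sum_le_tsum _ fun j _ => h0 j).trans h1
      have hM1 : ∑ j ∈ Fintype.piFinset fun _ : Fin m => Finset.range (N + 1),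
          ∏ i, μ i (j i) ≤ 1 := by
        rw [← Finset.prod_univ_sum]
        exact Finset.prod_le_one (fun i _ => Finset.sum_nonneg fun j _ => (hμ i j).le)
          fun i _ => hμ1 i
      have hmain := sum_rpow_mul_rpow_le_one
        (Fintype.piFinset fun _ : Fin m => Finset.range (N + 1))
        (M := fun j : Fin m → ℕ => ∏ i, μ i (j i)) (B := fun j => ‖T fun i => y i (j i)‖ / D)
        (β := 1 - 1 / r) ha hβ hs0 (by linarith)
        (fun j => Finset.prod_nonneg fun i _ => (hμ i _).le)
        (fun j => div_nonneg (norm_nonneg _) hD0.le) hM1 hB1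
      have hterm : ∀ j ∈ Fintype.piFinset fun _ : Fin m => Finset.range (N + 1),
          ‖T fun i => x i (j i)‖ ^ s = D ^ s * ((∏ i, μ i (j i)) ^ (1 - 1 / r) *
            (‖T fun i => y i (j i)‖ / D)) ^ s := by
        intro j hj
        rw [Fintype.mem_piFinset] at hj
        have hxy : (fun i => x i (j i)) = fun i => (μ i (j i) ^ (1 - 1 / r)) • y i (j i) := by
          funext i
          have hji := Finset.mem_range.1 (hj i)
          simp only [hy, reweight, if_pos hji]
          rw [smul_inv_smul₀ (Real.rpow_pos_of_pos (hμ i _) _).ne']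
        have hM0 : 0 ≤ (∏ i, μ i (j i)) ^ (1 - 1 / r) :=
          Real.rpow_nonneg (Finset.prod_nonneg fun i _ => (hμ i _).le) _
        rw [hxy, ContinuousMultilinearMap.map_smul_univ, norm_smul,
          Real.finsetProd_rpow _ _ fun i _ => (hμ i _).le, Real.norm_of_nonneg hM0,
          ← Real.mul_rpow hD0.le (mul_nonneg hM0 (div_nonneg (norm_nonneg _) hD0.le))]
        congr 1
        field_simp
      rw [Finset.sum_congr rfl hterm, ← Finset.mul_sum]
      exact mul_le_of_le_one_right (Real.rpow_nonneg hD0.le _) hmain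
    have hnn : ∀ j : Fin m → ℕ, 0 ≤ ‖T fun i => x i (j i)‖ ^ s := fun j =>
      Real.rpow_nonneg (norm_nonneg _) _
    have hfin : ∀ U : Finset (Fin m → ℕ), ∑ j ∈ U, ‖T fun i => x i (j i)‖ ^ s ≤ D ^ s := by
      intro U
      refine le_trans (Finset.sum_le_sum_of_subset_of_nonneg (fun j hj => ?_) fun j _ _ => hnn j)
        (hbox (U.sup fun j => Finset.univ.sup j))
      rw [Fintype.mem_piFinset]
      intro i
      rw [Finset.mem_range, Nat.lt_succ_iff]
      exact (Finset.le_sup (f := j) (Finset.mem_univ i)).trans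
        (Finset.le_sup (f := fun j : Fin m → ℕ => Finset.univ.sup j) hj)
    refine ⟨summable_of_sum_le hnn hfin, ?_⟩
    calc _ ≤ (D ^ s) ^ (1 / s) := Real.rpow_le_rpow (tsum_nonneg hnn)
          (Real.tsum_le_of_sum_le hnn hfin) (by positivity)
      _ = D := by rw [← Real.rpow_mul hD0.le, mul_one_div_cancel hs0.ne', Real.rpow_one]
      _ = _ := by rw [hD, Finset.prod_mul_distrib, mul_assoc]
  · push Not at hpos
    obtain ⟨i, hi⟩ := hpos
    have hzero : ∀ j : Fin m → ℕ, ‖T fun i => x i (j i)‖ ^ s = 0 := fun j => by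
      rw [T.map_coord_zero i ((hx i).eq_zero_of_weakNorm_le_zero hi (j i)), norm_zero,
        Real.zero_rpow hs0.ne']
    simp only [hzero, tsum_zero]
    refine ⟨summable_zero, ?_⟩
    rw [Real.zero_rpow (by positivity)]
    exact mul_nonneg (by positivity) (Finset.prod_nonneg fun i _ => weakNorm_nonneg _ _)

end
end

section
/- (Strings of coincidences, cotype 2 case) Let E and F be infinite dimensional Banach spaces with E of cotype 2. Let 1 ≤ r ≤ r_1 ≤ 2, r ≤ a ≤ a_1 < ∞ with 1/r − 1/a = 1/r_1 − 1/a_1. Then a continuous linear operator u : E → F is absolutely (a,r)-summing if and only if it is absolutely (a_1,r_1)-summing. -/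
open scoped ENNReal NNReal BigOperators ZeroAtInfty

noncomputable section

/-- Two points in the same dyadic interval of length `2⁻ⁿ` have the same first `n` Rademacher
signs. -/
lemma rademacher_eq_of_floor_eq {n k : ℕ} (hk : k < n) {s t : ℝ}
    (h : ⌊(2 : ℝ) ^ n * s⌋ = ⌊(2 : ℝ) ^ n * t⌋) : Rademacher k s = Rademacher k t := by
  have key : ∀ t : ℝ, ⌊(2 : ℝ) ^ (k + 1) * t⌋ =
      ⌊(2 : ℝ) ^ n * t⌋ / ((2 ^ (n - (k + 1)) : ℕ) : ℤ) := by
    intro t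
    rw [← Int.floor_div_natCast]
    congr 1
    push_cast
    have : (2 : ℝ) ^ n = 2 ^ (k + 1) * 2 ^ (n - (k + 1)) := by
      rw [← pow_add]; congr 1; omega
    rw [this]
    field_simp
  simp only [Rademacher, key, h]

lemma rademacher_last_even (n i : ℕ) :
    Rademacher n (((2 * i : ℕ) : ℝ) / 2 ^ (n + 1)) = 1 := by
  have : (2 : ℝ) ^ (n + 1) * (((2 * i : ℕ) : ℝ) / 2 ^ (n + 1)) = ((2 * i : ℤ) : ℝ) := by
    push_cast; field_simp
  rw [Rademacher, this, Int.floor_intCast, zpow_mul]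
  simp

lemma rademacher_last_odd (n i : ℕ) :
    Rademacher n (((2 * i + 1 : ℕ) : ℝ) / 2 ^ (n + 1)) = -1 := by
  have : (2 : ℝ) ^ (n + 1) * (((2 * i + 1 : ℕ) : ℝ) / 2 ^ (n + 1)) = ((2 * i + 1 : ℤ) : ℝ) := by
    push_cast; field_simp
  rw [Rademacher, this, Int.floor_intCast, zpow_add₀ (by norm_num), zpow_mul]
  simp

lemma rademacher_refine {n k i b : ℕ} (hk : k < n) (hb : b < 2) :
    Rademacher k (((2 * i + b : ℕ) : ℝ) / 2 ^ (n + 1)) = Rademacher k ((i : ℝ) / 2 ^ n) := by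
  refine rademacher_eq_of_floor_eq hk ?_
  have h1 : (2 : ℝ) ^ n * (((2 * i + b : ℕ) : ℝ) / 2 ^ (n + 1)) =
      ((2 * i + b : ℤ) : ℝ) / (2 : ℕ) := by
    push_cast; rw [pow_succ]; field_simp
  have h2 : (2 : ℝ) ^ n * ((i : ℝ) / 2 ^ n) = ((i : ℤ) : ℝ) := by
    push_cast; field_simp
  rw [h1, h2, Int.floor_div_natCast, Int.floor_intCast, Int.floor_intCast]
  push_cast
  omega

lemma sum_range_two_mul (f : ℕ → ℝ) (m : ℕ) :
    ∑ i ∈ Finset.range (2 * m), f i = ∑ i ∈ Finset.range m, (f (2 * i) + f (2 * i + 1)) := by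
  induction m with
  | zero => simp
  | succ m ih =>
    rw [show 2 * (m + 1) = 2 * m + 1 + 1 by ring, Finset.sum_range_succ, Finset.sum_range_succ, ih,
      Finset.sum_range_succ]
    ring

/-- The Rademacher polynomial `∑_{k < n} r_k a_k` on the `i`-th dyadic interval. -/
def dyadicSum (n : ℕ) (a : ℕ → ℝ) (i : ℕ) : ℝ :=
  ∑ k ∈ Finset.range n, Rademacher k ((i : ℝ) / 2 ^ n) * a k

lemma dyadicSum_succ_even (n : ℕ) (a : ℕ → ℝ) (i : ℕ) :
    dyadicSum (n + 1) a (2 * i) = dyadicSum n a i + a n := by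
  rw [dyadicSum, Finset.sum_range_succ, rademacher_last_even, one_mul, dyadicSum]
  congr 1
  refine Finset.sum_congr rfl fun k hk => ?_
  rw [← rademacher_refine (b := 0) (Finset.mem_range.1 hk) (by norm_num), add_zero]

lemma dyadicSum_succ_odd (n : ℕ) (a : ℕ → ℝ) (i : ℕ) :
    dyadicSum (n + 1) a (2 * i + 1) = dyadicSum n a i - a n := by
  rw [dyadicSum, Finset.sum_range_succ, rademacher_last_odd, neg_one_mul, dyadicSum, sub_eq_add_neg]
  congr 1
  refine Finset.sum_congr rfl fun k hk => ?_
  rw [← rademacher_refine (b := 1) (Finset.mem_range.1 hk) (by norm_num)]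

lemma sum_dyadicSum_sq (n : ℕ) (a : ℕ → ℝ) :
    ∑ i ∈ Finset.range (2 ^ n), dyadicSum n a i ^ 2 = 2 ^ n * ∑ k ∈ Finset.range n, a k ^ 2 := by
  induction n with
  | zero => simp [dyadicSum]
  | succ n ih =>
    rw [pow_succ', sum_range_two_mul]
    have : ∀ i, dyadicSum (n + 1) a (2 * i) ^ 2 + dyadicSum (n + 1) a (2 * i + 1) ^ 2
        = 2 * dyadicSum n a i ^ 2 + 2 * a n ^ 2 := by
      intro i; rw [dyadicSum_succ_even, dyadicSum_succ_odd]; ring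
    simp only [this, Finset.sum_add_distrib, ← Finset.mul_sum, ih, Finset.sum_const,
      Finset.card_range, Finset.sum_range_succ, nsmul_eq_mul]
    push_cast
    ring

/-- Khinchine's inequality for the fourth moment. -/
lemma sum_dyadicSum_pow_four_le (n : ℕ) (a : ℕ → ℝ) :
    ∑ i ∈ Finset.range (2 ^ n), dyadicSum n a i ^ 4 ≤
      2 ^ n * (3 * (∑ k ∈ Finset.range n, a k ^ 2) ^ 2) := by
  induction n with
  | zero => simp [dyadicSum]
  | succ n ih =>
    rw [pow_succ', sum_range_two_mul]
    have : ∀ i, dyadicSum (n + 1) a (2 * i) ^ 4 + dyadicSum (n + 1) a (2 * i + 1) ^ 4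
        = 2 * dyadicSum n a i ^ 4 + (12 * a n ^ 2) * dyadicSum n a i ^ 2 + 2 * a n ^ 4 := by
      intro i; rw [dyadicSum_succ_even, dyadicSum_succ_odd]; ring
    simp only [this, Finset.sum_add_distrib, ← Finset.mul_sum, sum_dyadicSum_sq, Finset.sum_const,
      Finset.card_range, Finset.sum_range_succ, nsmul_eq_mul]
    push_cast
    have h4 : 0 ≤ (2 : ℝ) ^ n * a n ^ 4 := by positivity
    rw [pow_succ' (2 : ℝ) n]
    nlinarith

/-- The integral of a function of the first `n` Rademacher functions is an average over dyadic
intervals. -/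
lemma integral_rademacher (n : ℕ) (G : (Fin n → ℝ) → ℝ) :
    ∫ t in (0 : ℝ)..1, G (fun k => Rademacher k t) =
      (2 ^ n)⁻¹ * ∑ i ∈ Finset.range (2 ^ n), G (fun k => Rademacher k ((i : ℝ) / 2 ^ n)) := by
  have hle : ∀ i : ℕ, (i : ℝ) / 2 ^ n ≤ ((i + 1 : ℕ) : ℝ) / 2 ^ n := by
    intro i; gcongr; simp
  have hcongr : ∀ i : ℕ, Set.EqOn (fun t => G (fun k : Fin n => Rademacher k t))
      (fun _ => G (fun k : Fin n => Rademacher k ((i : ℝ) / 2 ^ n)))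
      (Set.Ioo ((i : ℝ) / 2 ^ n) (((i + 1 : ℕ) : ℝ) / 2 ^ n)) := by
    intro i t ht
    have hpos : (0 : ℝ) < 2 ^ n := by positivity
    have h1 := (div_lt_iff₀ hpos).1 ht.1
    have h2 := (lt_div_iff₀ hpos).1 ht.2
    have hfl : ⌊(2 : ℝ) ^ n * t⌋ = (i : ℤ) := by
      rw [Int.floor_eq_iff]
      push_cast at h2 ⊢
      constructor <;> linarith
    dsimp only
    congr 1
    funext k
    refine rademacher_eq_of_floor_eq k.2 ?_
    rw [hfl, mul_div_cancel₀ _ hpos.ne', Int.floor_natCast]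
  have hsum := intervalIntegral.sum_integral_adjacent_intervals
    (μ := MeasureTheory.volume) (f := fun t => G (fun k : Fin n => Rademacher k t))
    (a := fun i : ℕ => (i : ℝ) / 2 ^ n) (n := 2 ^ n) (fun i _ => by
      refine (intervalIntegrable_const
        (c := G (fun k : Fin n => Rademacher k ((i : ℝ) / 2 ^ n)))).congr_uIoo ?_
      rw [Set.uIoo_of_le (hle i)]
      exact (hcongr i).symm)
  have h0 : ((0 : ℕ) : ℝ) / 2 ^ n = 0 := by simp
  have h1 : ((2 ^ n : ℕ) : ℝ) / 2 ^ n = 1 := by push_cast; field_simp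
  rw [h0, h1] at hsum
  rw [← hsum, Finset.mul_sum]
  refine Finset.sum_congr rfl fun i _ => ?_
  rw [intervalIntegral.integral_congr_Ioo_of_le (hle i) (hcongr i), intervalIntegral.integral_const,
    smul_eq_mul]
  push_cast
  ring

lemma HasCotype.exists_dyadic_bound {E : Type*} [NormedAddCommGroup E] [NormedSpace ℝ E]
    (h : HasCotype 2 E) : ∃ C > 0, ∀ (n : ℕ) (x : ℕ → E),
      ∑ k ∈ Finset.range n, ‖x k‖ ^ 2 ≤ C * ((2 ^ n)⁻¹ * ∑ i ∈ Finset.range (2 ^ n),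
        ‖∑ k ∈ Finset.range n, Rademacher k ((i : ℝ) / 2 ^ n) • x k‖ ^ 2) := by
  obtain ⟨-, C, hC, h⟩ := h
  refine ⟨C ^ 2, by positivity, fun n x => ?_⟩
  have hx := h n (fun k => x k)
  rw [integral_rademacher n (fun v => ‖∑ k : Fin n, v k • x k‖ ^ 2)] at hx
  simp only [Finset.sum_range] at hx ⊢
  set A := ∑ k : Fin n, ‖x k‖ ^ 2
  set B := ((2 : ℝ) ^ n)⁻¹ * ∑ i : Fin (2 ^ n),
    ‖∑ k : Fin n, Rademacher k (((i : ℕ) : ℝ) / 2 ^ n) • x k‖ ^ 2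
  have hA : 0 ≤ A := by positivity
  have hB : 0 ≤ B := by positivity
  have hx' : √A ≤ C * √B := by
    rw [Real.sqrt_eq_rpow, Real.sqrt_eq_rpow]
    simpa [A] using hx
  calc A = √A ^ 2 := (Real.sq_sqrt hA).symm
    _ ≤ (C * √B) ^ 2 := by gcongr
    _ = C ^ 2 * B := by rw [mul_pow, Real.sq_sqrt hB]

/-- A pointwise interpolation between the norm of an operator on `ℓ_∞` and its values on squares. -/
lemma exists_norm_sum_sq_le {E : Type*} [NormedAddCommGroup E] [NormedSpace ℝ E]
    {ι : Type*} (s : Finset ι) (x : ι → E) {W : ℝ}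
    (hW : ∀ φ : E →L[ℝ] ℝ, ‖φ‖ ≤ 1 → ∑ j ∈ s, |φ (x j)| ≤ W) (g : ι → ℝ) :
    ∃ h : ι → ℝ, (∀ j, h j ^ 2 = g j ^ 4) ∧ ‖∑ j ∈ s, g j • x j‖ ^ 2 ≤ W * ‖∑ j ∈ s, h j • x j‖ := by
  obtain ⟨φ, hφ, hv⟩ := exists_dual_vector'' ℝ (∑ j ∈ s, g j • x j)
  refine ⟨fun j => if 0 ≤ φ (x j) then g j ^ 2 else -g j ^ 2, fun j => ?_, ?_⟩
  · dsimp only; split_ifs <;> ring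
  have hle : ∑ j ∈ s, |φ (x j)| * g j ^ 2 ≤
      ‖∑ j ∈ s, (if 0 ≤ φ (x j) then g j ^ 2 else -g j ^ 2) • x j‖ := by
    refine le_trans (le_of_eq ?_)
      ((le_abs_self _).trans ((φ.le_of_opNorm_le hφ _).trans_eq (one_mul _)))
    simp only [map_sum, map_smul, smul_eq_mul]
    refine Finset.sum_congr rfl fun j _ => ?_
    split_ifs with h0
    · rw [abs_of_nonneg h0]; ring
    · rw [abs_of_neg (not_le.1 h0)]; ring
  have hv' : ‖∑ j ∈ s, g j • x j‖ = ∑ j ∈ s, g j * φ (x j) := by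
    simp only [RCLike.ofReal_real_eq_id, id] at hv
    rw [← hv]; simp
  rw [hv']
  calc (∑ j ∈ s, g j * φ (x j)) ^ 2
      ≤ (∑ j ∈ s, |φ (x j)|) * ∑ j ∈ s, |φ (x j)| * g j ^ 2 := by
        refine Finset.sum_sq_le_sum_mul_sum_of_sq_le_mul s (fun _ _ => abs_nonneg _)
          (fun _ _ => by positivity) fun j _ => le_of_eq ?_
        rw [← mul_assoc, abs_mul_abs_self]; ring
    _ ≤ W * _ := by
        gcongr
        · exact (Finset.sum_nonneg fun _ _ => abs_nonneg _).trans (hW φ hφ)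
        · exact hW φ hφ

/-- Operators from `ℓ_∞` into a space of cotype 2 are 2-concave. -/
lemma sum_norm_sq_le_of_cotype {E : Type*} [NormedAddCommGroup E] [NormedSpace ℝ E] {C : ℝ}
    (hC0 : 0 < C)
    (hC : ∀ (n : ℕ) (x : ℕ → E),
      ∑ k ∈ Finset.range n, ‖x k‖ ^ 2 ≤ C * ((2 ^ n)⁻¹ * ∑ i ∈ Finset.range (2 ^ n),
        ‖∑ k ∈ Finset.range n, Rademacher k ((i : ℝ) / 2 ^ n) • x k‖ ^ 2))
    {ι : Type*} (s : Finset ι) (x : ι → E) {W : ℝ}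
    (hW : ∀ φ : E →L[ℝ] ℝ, ‖φ‖ ≤ 1 → ∑ j ∈ s, |φ (x j)| ≤ W) (n : ℕ) (f : ℕ → ι → ℝ)
    (hf : ∀ j ∈ s, ∑ k ∈ Finset.range n, f k j ^ 2 ≤ 1) :
    ∑ k ∈ Finset.range n, ‖∑ j ∈ s, f k j • x j‖ ^ 2 ≤ 3 * C ^ 2 * W ^ 2 := by
  have hW0 : 0 ≤ W := by simpa using hW 0 (by simp)
  set S : Set ℝ := {v | ∃ (n : ℕ) (f : ℕ → ι → ℝ),
    (∀ j ∈ s, ∑ k ∈ Finset.range n, f k j ^ 2 ≤ 1) ∧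
      v = ∑ k ∈ Finset.range n, ‖∑ j ∈ s, f k j • x j‖ ^ 2}
  have hbdd : BddAbove S := by
    refine ⟨s.card * ∑ j ∈ s, ‖x j‖ ^ 2, ?_⟩
    rintro v ⟨n, f, hf, rfl⟩
    calc ∑ k ∈ Finset.range n, ‖∑ j ∈ s, f k j • x j‖ ^ 2
        ≤ ∑ k ∈ Finset.range n, s.card * ∑ j ∈ s, f k j ^ 2 * ‖x j‖ ^ 2 := by
          refine Finset.sum_le_sum fun k _ => ?_
          calc ‖∑ j ∈ s, f k j • x j‖ ^ 2 ≤ (∑ j ∈ s, ‖f k j • x j‖) ^ 2 := by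
                gcongr; exact norm_sum_le _ _
            _ ≤ s.card * ∑ j ∈ s, ‖f k j • x j‖ ^ 2 := sq_sum_le_card_mul_sum_sq
            _ = _ := by simp [norm_smul, mul_pow]
      _ = s.card * ∑ j ∈ s, (∑ k ∈ Finset.range n, f k j ^ 2) * ‖x j‖ ^ 2 := by
          rw [← Finset.mul_sum, Finset.sum_comm]
          simp only [Finset.sum_mul]
      _ ≤ s.card * ∑ j ∈ s, ‖x j‖ ^ 2 := by
          gcongr with j hj
          exact mul_le_of_le_one_left (by positivity) (hf j hj)
  set M := sSup S
  have hM0 : 0 ≤ M := le_csSup hbdd ⟨0, fun _ _ => 0, by simp, by simp⟩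
  have hstep : ∀ v ∈ S, v ≤ C * (W * √(3 * M)) := by
    rintro v ⟨n, f, hf, rfl⟩
    set g : ℕ → ι → ℝ := fun i j => dyadicSum n (fun k => f k j) i with hg
    choose h hh hle using fun i => exists_norm_sum_sq_le s x hW (g i)
    have hgsum : ∀ i : ℕ, ∑ k ∈ Finset.range n, Rademacher k ((i : ℝ) / 2 ^ n) • ∑ j ∈ s, f k j • x j
        = ∑ j ∈ s, g i j • x j := by
      intro i
      simp only [Finset.smul_sum, smul_smul, hg, dyadicSum, Finset.sum_smul]
      rw [Finset.sum_comm]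
    have hmem : ∑ i ∈ Finset.range (2 ^ n), ‖∑ j ∈ s, h i j • x j‖ ^ 2 ≤ 2 ^ n * (3 * M) := by
      have hsq : ((√(2 ^ n * 3))⁻¹ : ℝ) ^ 2 = (2 ^ n * 3)⁻¹ := by
        rw [inv_pow, Real.sq_sqrt (by positivity)]
      have := le_csSup hbdd ⟨2 ^ n, fun i j => (√(2 ^ n * 3))⁻¹ * h i j, fun j hj => ?_, rfl⟩
      · simp only [mul_smul, ← Finset.smul_sum, norm_smul, mul_pow, norm_inv, Real.norm_eq_abs,
          inv_pow, sq_abs] at this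
        rw [← Finset.mul_sum, ← inv_pow, hsq, inv_mul_le_iff₀ (by positivity)] at this
        linarith
      · simp only [mul_pow, hsq, hh, ← Finset.mul_sum]
        rw [inv_mul_le_iff₀ (by positivity), mul_one]
        refine (sum_dyadicSum_pow_four_le n fun k => f k j).trans ?_
        have h1 := hf j hj
        have h2 : (∑ k ∈ Finset.range n, f k j ^ 2) ^ 2 ≤ 1 :=
          pow_le_one₀ (by positivity) h1
        gcongr
        linarith
    refine (hC n _).trans ?_
    simp only [hgsum]
    refine mul_le_mul_of_nonneg_left ?_ hC0.le
    rw [inv_mul_le_iff₀ (by positivity)]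
    have hcs : (∑ i ∈ Finset.range (2 ^ n), ‖∑ j ∈ s, h i j • x j‖) ≤ 2 ^ n * √(3 * M) := by
      refine abs_le_of_sq_le_sq' ?_ (by positivity) |>.2
      rw [mul_pow, Real.sq_sqrt (by positivity)]
      refine sq_sum_le_card_mul_sum_sq.trans ?_
      rw [Finset.card_range, pow_two ((2 : ℝ) ^ n), mul_assoc]
      push_cast
      gcongr
    calc _ ≤ ∑ i ∈ Finset.range (2 ^ n), W * ‖∑ j ∈ s, h i j • x j‖ :=
          Finset.sum_le_sum fun i _ => hle i
      _ = W * ∑ i ∈ Finset.range (2 ^ n), ‖∑ j ∈ s, h i j • x j‖ := by rw [Finset.mul_sum]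
      _ ≤ W * (2 ^ n * √(3 * M)) := by gcongr
      _ = 2 ^ n * (W * √(3 * M)) := by ring
  have hM : M ≤ C * (W * √(3 * M)) :=
    csSup_le ⟨0, 0, fun _ _ => 0, by simp, by simp⟩ hstep
  refine (le_csSup hbdd ⟨n, f, hf, rfl⟩).trans (?_ : M ≤ _)
  have h2 : M ^ 2 ≤ C ^ 2 * W ^ 2 * (3 * M) := by
    calc M ^ 2 ≤ (C * (W * √(3 * M))) ^ 2 := by gcongr
      _ = _ := by rw [mul_pow, mul_pow, Real.sq_sqrt (by positivity)]; ring
  rcases hM0.eq_or_lt with h0 | h0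
  · rw [← h0]; positivity
  · have : M * M ≤ (3 * C ^ 2 * W ^ 2) * M := by nlinarith
    exact le_of_mul_le_mul_right this h0

/-- A compact convex set meets an intersection of half-spaces as soon as it meets every finite
conic combination of them. -/
lemma exists_forall_le_of_conic_combination {X : Type*} [AddCommGroup X] [Module ℝ X]
    [TopologicalSpace X] {κ : Type*} {Λ : Set X} (hconv : Convex ℝ Λ) (hcomp : IsCompact Λ)
    (ℓ : κ → X →L[ℝ] ℝ) (c : κ → ℝ)
    (h : ∀ (I : Finset κ) (β : κ → ℝ), (∀ i, 0 ≤ β i) →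
      ∃ m ∈ Λ, ∑ i ∈ I, β i * c i ≤ ∑ i ∈ I, β i * ℓ i m) :
    ∃ m ∈ Λ, ∀ i, c i ≤ ℓ i m := by
  have hne := hcomp.inter_iInter_nonempty (fun i => {m | c i ≤ ℓ i m})
    (fun i => isClosed_le continuous_const (ℓ i).continuous) (fun I => ?_)
  · obtain ⟨m, hm, hm'⟩ := hne
    exact ⟨m, hm, fun i => Set.mem_iInter.1 hm' i⟩
  classical
  by_contra hempty
  let L : X →L[ℝ] (I → ℝ) := ContinuousLinearMap.pi fun i : I => ℓ i
  have hdisj : Disjoint (L '' Λ) (Set.Ici fun i : I => c i) := by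
    rw [Set.disjoint_left]
    rintro _ ⟨m, hm, rfl⟩ hge
    refine hempty ⟨m, hm, ?_⟩
    simp only [Set.mem_iInter]
    exact fun i hi => hge ⟨i, hi⟩
  obtain ⟨f, a, b, hfa, hab, hfb⟩ := geometric_hahn_banach_compact_closed
    (hconv.linear_image L.toLinearMap) (hcomp.image L.continuous) (convex_Ici _) isClosed_Ici hdisj
  have hf : ∀ z : I → ℝ, f z = ∑ i, f (Pi.single i 1) * z i := by
    intro z
    conv_lhs => rw [pi_eq_sum_univ' z]
    simp [map_sum, mul_comm, Pi.single]
  have hnonneg : ∀ i, 0 ≤ f (Pi.single i 1) := by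
    intro i
    by_contra! hneg
    have hb : ∀ t : ℝ, 0 ≤ t → b < f (fun i : I => c i) + t * f (Pi.single i 1) := by
      intro t ht
      have := hfb ((fun i : I => c i) + t • Pi.single i (1 : ℝ)) (by
        rw [Set.mem_Ici]
        refine le_add_of_nonneg_right (smul_nonneg ht ?_)
        exact Pi.single_nonneg.2 zero_le_one)
      simpa using this
    have h0 := hb 0 le_rfl
    have h1 := hb ((f (fun i : I => c i) - b) / -f (Pi.single i 1))
      (div_nonneg (by linarith) (by linarith))
    rw [div_mul_eq_mul_div, div_neg, mul_div_assoc, div_self hneg.ne] at h1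
    linarith
  let β : κ → ℝ := fun i => if hi : i ∈ I then f (Pi.single ⟨i, hi⟩ 1) else 0
  have hβ : ∀ i : I, β i = f (Pi.single i 1) := fun i => dif_pos i.2
  obtain ⟨m, hm, hle⟩ := h I β fun i => by
    simp only [β]; split_ifs; exacts [hnonneg _, le_rfl]
  have h1 := hfa _ ⟨m, hm, rfl⟩
  have h2 := hfb (fun i : I => c i) Set.self_mem_Ici
  rw [hf] at h1 h2
  rw [← Finset.sum_coe_sort I, ← Finset.sum_coe_sort I] at hle
  simp only [hβ] at hle
  change ∑ i : I, f (Pi.single i 1) * ℓ i m < a at h1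
  linarith

/-- Weakly `r`-summable sequences are uniformly so on the unit ball of the dual. -/
lemma WeaklySummable.exists_bound {E : Type*} [NormedAddCommGroup E] [NormedSpace ℝ E]
    {r : ℝ} (hr : 1 ≤ r) {x : ℕ → E} (hx : WeaklySummable r x) :
    ∃ W > 0, ∀ φ : E →L[ℝ] ℝ, ‖φ‖ ≤ 1 → ∀ s : Finset ℕ, ∑ j ∈ s, |φ (x j)| ^ r ≤ W ^ r := by
  have hr0 : 0 < r := by linarith
  have : Fact (1 ≤ ENNReal.ofReal r) := ⟨by simpa using ENNReal.ofReal_le_ofReal hr⟩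
  have htr : (ENNReal.ofReal r).toReal = r := ENNReal.toReal_ofReal hr0.le
  let T : Finset ℕ → (E →L[ℝ] ℝ) →L[ℝ] lp (fun _ : ℕ => ℝ) (ENNReal.ofReal r) := fun s =>
    ∑ j ∈ s, (lp.singleContinuousLinearMap ℝ (fun _ : ℕ => ℝ) (ENNReal.ofReal r) j).comp
      (ContinuousLinearMap.apply ℝ ℝ (x j))
  have hT : ∀ s φ, ‖T s φ‖ = (∑ j ∈ s, |φ (x j)| ^ r) ^ (1 / r) := by
    intro s φ
    have h := lp.norm_sum_single (p := ENNReal.ofReal r) (by rw [htr]; exact hr0)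
      (fun j => φ (x j)) s
    rw [htr] at h
    have h' : T s φ = ∑ j ∈ s, lp.single (ENNReal.ofReal r) j (φ (x j)) := by
      simp [T]
    simp only [Real.norm_eq_abs] at h
    rw [h', ← h, ← Real.rpow_mul (norm_nonneg _), mul_one_div_cancel hr0.ne', Real.rpow_one]
  obtain ⟨W, hW⟩ := banach_steinhaus (g := T) fun φ => by
    refine ⟨(∑' j, |φ (x j)| ^ r) ^ (1 / r), fun s => ?_⟩
    rw [hT]
    gcongr
    exact (hx φ).sum_le_tsum s fun j _ => by positivity
  refine ⟨max W 1, by positivity, fun φ hφ s => ?_⟩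
  have h1 : (∑ j ∈ s, |φ (x j)| ^ r) ^ (1 / r) ≤ max W 1 := by
    rw [← hT]
    calc ‖T s φ‖ ≤ ‖T s‖ * ‖φ‖ := (T s).le_opNorm φ
      _ ≤ ‖T s‖ * 1 := by gcongr
      _ ≤ max W 1 := by rw [mul_one]; exact (hW s).trans (le_max_left _ _)
  have hS : 0 ≤ ∑ j ∈ s, |φ (x j)| ^ r := by positivity
  calc ∑ j ∈ s, |φ (x j)| ^ r = ((∑ j ∈ s, |φ (x j)| ^ r) ^ (1 / r)) ^ r := by
        rw [← Real.rpow_mul hS, one_div, inv_mul_cancel₀ hr0.ne', Real.rpow_one]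
    _ ≤ (max W 1) ^ r := by gcongr

/-- The positive part of the unit ball of `ℓ_p`. -/
def positiveBall (p : ℝ) : Set (ℕ → ℝ) :=
  {m | (∀ j, 0 ≤ m j) ∧ ∀ s : Finset ℕ, ∑ j ∈ s, m j ^ p ≤ 1}

lemma convex_positiveBall {p : ℝ} (hp : 1 ≤ p) : Convex ℝ (positiveBall p) := by
  rintro m ⟨hm0, hm⟩ m' ⟨hm0', hm'⟩ a b ha hb hab
  refine ⟨fun j => add_nonneg (mul_nonneg ha (hm0 j)) (mul_nonneg hb (hm0' j)), fun s => ?_⟩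
  calc ∑ j ∈ s, (a • m + b • m') j ^ p ≤ ∑ j ∈ s, (a * m j ^ p + b * m' j ^ p) :=
        Finset.sum_le_sum fun j _ => (convexOn_rpow hp).2 (hm0 j) (hm0' j) ha hb hab
    _ = a * ∑ j ∈ s, m j ^ p + b * ∑ j ∈ s, m' j ^ p := by
        rw [Finset.sum_add_distrib, Finset.mul_sum, Finset.mul_sum]
    _ ≤ a * 1 + b * 1 := by gcongr <;> [exact hm s; exact hm' s]
    _ = 1 := by rw [mul_one, mul_one, hab]

lemma isCompact_positiveBall {p : ℝ} (hp : 0 < p) : IsCompact (positiveBall p) := by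
  refine (isCompact_univ_pi fun _ : ℕ => isCompact_Icc (a := (0 : ℝ)) (b := 1)).of_isClosed_subset
    ?_ ?_
  · have : positiveBall p = (⋂ j, {m : ℕ → ℝ | 0 ≤ m j}) ∩
        ⋂ s : Finset ℕ, {m : ℕ → ℝ | ∑ j ∈ s, m j ^ p ≤ 1} := by
      ext m; simp [positiveBall]
    rw [this]
    refine (isClosed_iInter fun j => isClosed_le continuous_const (continuous_apply j)).inter
      (isClosed_iInter fun s => isClosed_le ?_ continuous_const)
    exact continuous_finsetSum _ fun j _ => (continuous_apply j).rpow_const fun _ => Or.inr hp.le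
  · rintro m ⟨hm0, hm⟩ j -
    refine ⟨hm0 j, ?_⟩
    by_contra! hlt
    have := hm {j}
    rw [Finset.sum_singleton] at this
    exact absurd (Real.one_lt_rpow hlt hp) (not_lt.2 this)

lemma exists_enumeration {κ : Type*} [Inhabited κ] (I : Finset κ) :
    ∃ g : ℕ → κ, ∀ F : κ → ℝ, ∑ k ∈ Finset.range I.card, F (g k) = ∑ i ∈ I, F i := by
  refine ⟨fun k => if h : k < I.card then (I.equivFin.symm ⟨k, h⟩ : κ) else default, fun F => ?_⟩
  rw [Finset.sum_range, ← Finset.sum_coe_sort I, ← Equiv.sum_comp I.equivFin.symm]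
  simp

/-- The domination underlying the factorization theorem: a weakly `r`-summable sequence in a space
of cotype 2 defines an operator on finite sequences bounded by a weighted `ℓ_2` norm. -/
lemma HasCotype.exists_weight {E : Type*} [NormedAddCommGroup E] [NormedSpace ℝ E]
    (hE : HasCotype 2 E) {r : ℝ} (hr : 1 ≤ r) (hr2 : r < 2) {x : ℕ → E}
    (hx : WeaklySummable r x) :
    ∃ m ∈ positiveBall (r / (2 - r)), ∃ K, 0 ≤ K ∧ ∀ (s : Finset ℕ) (a : ℕ → ℝ),
      ‖∑ j ∈ s, a j • x j‖ ^ 2 ≤ K * ∑ j ∈ s, a j ^ 2 * m j := by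
  classical
  obtain ⟨C, hC0, hC⟩ := hE.exists_dyadic_bound
  obtain ⟨W, hW0, hW⟩ := hx.exists_bound hr
  have h2r : 0 < 2 - r := by linarith
  have hp : 1 ≤ r / (2 - r) := by rw [le_div_iff₀ h2r]; linarith
  have hcomp := isCompact_positiveBall (p := r / (2 - r)) (by linarith)
  set K : ℝ := 3 * C ^ 2 * W ^ 2 with hK
  let ℓ : Finset ℕ × (ℕ → ℝ) → (ℕ → ℝ) →L[ℝ] ℝ := fun v =>
    K • ∑ j ∈ v.1, v.2 j ^ 2 • ContinuousLinearMap.proj j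
  have hℓ : ∀ v m, ℓ v m = K * ∑ j ∈ v.1, v.2 j ^ 2 * m j := by
    intro v m; simp [ℓ]
  suffices hfin : ∀ (I : Finset (Finset ℕ × (ℕ → ℝ))) (β : Finset ℕ × (ℕ → ℝ) → ℝ),
      (∀ v, 0 ≤ β v) → ∃ m ∈ positiveBall (r / (2 - r)),
        ∑ v ∈ I, β v * ‖∑ j ∈ v.1, v.2 j • x j‖ ^ 2 ≤ ∑ v ∈ I, β v * ℓ v m by
    obtain ⟨m, hm, hle⟩ := exists_forall_le_of_conic_combination (convex_positiveBall hp) hcomp ℓ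
      (fun v => ‖∑ j ∈ v.1, v.2 j • x j‖ ^ 2) hfin
    exact ⟨m, hm, K, by positivity, fun s a => by simpa only [hℓ] using hle (s, a)⟩
  intro I β hβ
  set s : Finset ℕ := I.biUnion Prod.fst with hs
  set q : Finset ℕ × (ℕ → ℝ) → ℕ → ℝ := fun v j => √(β v) * if j ∈ v.1 then v.2 j else 0 with hq
  have hq2 : ∀ v j, q v j ^ 2 = β v * if j ∈ v.1 then v.2 j ^ 2 else 0 := by
    intro v j
    simp only [hq, mul_pow, Real.sq_sqrt (hβ v)]
    split_ifs <;> simp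
  set H : ℕ → ℝ := fun j => ∑ v ∈ I, q v j ^ 2 with hH
  have hH0 : ∀ j, 0 ≤ H j := fun j => by positivity
  have hsub : ∀ v ∈ I, v.1 ⊆ s := fun v hv => Finset.subset_biUnion_of_mem Prod.fst hv
  have hright : ∀ m, ∑ v ∈ I, β v * ℓ v m = K * ∑ j ∈ s, H j * m j := by
    intro m
    simp only [hH, Finset.sum_mul]
    rw [Finset.sum_comm, Finset.mul_sum]
    refine Finset.sum_congr rfl fun v hv => ?_
    simp only [hℓ, hq2, mul_assoc, ← Finset.mul_sum, ite_mul, zero_mul]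
    rw [← Finset.sum_filter, Finset.filter_mem_eq_inter, Finset.inter_eq_right.2 (hsub v hv)]
    ring
  have hvec : ∀ v ∈ I, ∑ j ∈ s, q v j • x j = √(β v) • ∑ j ∈ v.1, v.2 j • x j := by
    intro v hv
    simp only [hq, mul_smul, ← Finset.smul_sum, ite_smul, zero_smul]
    rw [← Finset.sum_filter, Finset.filter_mem_eq_inter, Finset.inter_eq_right.2 (hsub v hv)]
  have hleft : ∑ v ∈ I, β v * ‖∑ j ∈ v.1, v.2 j • x j‖ ^ 2
      = ∑ v ∈ I, ‖∑ j ∈ s, q v j • x j‖ ^ 2 := by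
    refine Finset.sum_congr rfl fun v hv => ?_
    rw [hvec v hv, norm_smul, mul_pow, Real.norm_eq_abs, sq_abs, Real.sq_sqrt (hβ v)]
  have hcont : Continuous fun m : ℕ → ℝ => ∑ j ∈ s, H j * m j :=
    continuous_finsetSum _ fun j _ => continuous_const.mul (continuous_apply j)
  obtain ⟨m, hm, hmax⟩ := hcomp.exists_isMaxOn ⟨0, fun _ => le_rfl, fun t => by
    simp [Real.zero_rpow (by positivity : r / (2 - r) ≠ 0)]⟩ hcont.continuousOn
  refine ⟨m, hm, ?_⟩
  rw [hright, hleft]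
  set V := ∑ j ∈ s, H j * m j with hV
  have hV0 : 0 ≤ V := Finset.sum_nonneg fun j _ => mul_nonneg (hH0 j) (hm.1 j)
  have hbound : ∀ φ : E →L[ℝ] ℝ, ‖φ‖ ≤ 1 → ∑ j ∈ s, |φ (√(H j) • x j)| ≤ W * √V := by
    intro φ hφ
    set t : ℕ → ℝ := fun j => |φ (x j)| / W with ht
    have ht0 : ∀ j, 0 ≤ t j := fun j => by positivity
    have htr : ∀ s : Finset ℕ, ∑ j ∈ s, t j ^ r ≤ 1 := by
      intro s
      simp only [ht, Real.div_rpow (abs_nonneg _) hW0.le, ← Finset.sum_div]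
      exact div_le_one_of_le₀ (hW φ hφ s) (by positivity)
    have htm : (fun j => t j ^ (2 - r)) ∈ positiveBall (r / (2 - r)) := by
      refine ⟨fun j => by positivity, fun s => ?_⟩
      simpa only [← Real.rpow_mul (ht0 _), mul_div_cancel₀ r h2r.ne'] using htr s
    refine abs_le_of_sq_le_sq' ?_ (by positivity) |>.2
    rw [mul_pow, Real.sq_sqrt hV0]
    calc (∑ j ∈ s, |φ (√(H j) • x j)|) ^ 2
        ≤ (∑ j ∈ s, W ^ 2 * t j ^ r) * ∑ j ∈ s, H j * t j ^ (2 - r) := by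
          refine Finset.sum_sq_le_sum_mul_sum_of_sq_le_mul s (fun j _ => by positivity)
            (fun j _ => mul_nonneg (hH0 j) (by positivity)) fun j _ => le_of_eq ?_
          have h1 : t j ^ r * t j ^ (2 - r) = t j ^ 2 := by
            rw [← Real.rpow_add_of_nonneg (ht0 j) (by linarith) h2r.le, add_sub_cancel,
              Real.rpow_two]
          have h2 : |φ (x j)| = W * t j := by
            simp only [ht]; field_simp
          rw [map_smul, smul_eq_mul, abs_mul, abs_of_nonneg (Real.sqrt_nonneg _), mul_pow,
            Real.sq_sqrt (hH0 j), h2, mul_pow, ← h1]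
          ring
      _ ≤ W ^ 2 * V := by
          rw [← Finset.mul_sum]
          refine mul_le_mul ?_ (hmax htm) (Finset.sum_nonneg fun j _ =>
            mul_nonneg (hH0 j) (by positivity)) (by positivity)
          exact mul_le_of_le_one_right (by positivity) (htr s)
  obtain ⟨g, hg⟩ := exists_enumeration I
  have hmain := sum_norm_sq_le_of_cotype hC0 hC s (fun j => √(H j) • x j) hbound I.card
    (fun k j => q (g k) j / √(H j)) (fun j _ => by
      rw [hg fun v => (q v j / √(H j)) ^ 2]
      simp only [div_pow, Real.sq_sqrt (hH0 j), ← Finset.sum_div]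
      exact div_self_le_one _)
  rw [hg fun v => ‖∑ j ∈ s, (q v j / √(H j)) • √(H j) • x j‖ ^ 2, mul_pow, Real.sq_sqrt hV0] at hmain
  refine le_trans (le_of_eq ?_) (hmain.trans_eq (by rw [hK]; ring))
  refine Finset.sum_congr rfl fun v hv => ?_
  congr 2
  refine Finset.sum_congr rfl fun j _ => ?_
  rw [smul_smul]
  congr 1
  refine (div_mul_cancel_of_imp fun h0 => ?_).symm
  have h1 : H j = 0 := (Real.sqrt_eq_zero (hH0 j)).1 h0
  have h2 := (Finset.sum_eq_zero_iff_of_nonneg fun v _ => sq_nonneg (q v j)).1 h1 v hv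
  exact pow_eq_zero_iff two_ne_zero |>.1 h2

/-- In a space of cotype 2, weakly `r`-summable sequences factor through weakly 2-summable ones. -/
lemma HasCotype.exists_factorization {E : Type*} [NormedAddCommGroup E] [NormedSpace ℝ E]
    (hE : HasCotype 2 E) {r : ℝ} (hr : 1 ≤ r) (hr2 : r < 2) {x : ℕ → E}
    (hx : WeaklySummable r x) :
    ∃ (d : ℕ → ℝ) (y : ℕ → E), (∀ j, 0 ≤ d j) ∧ Summable d ∧ WeaklySummable 2 y ∧
      ∀ j, x j = d j ^ (1 / r - 1 / 2) • y j := by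
  obtain ⟨m, ⟨hm0, hm⟩, K, hK, h⟩ := hE.exists_weight hr hr2 hx
  have h2r : 0 < 2 - r := by linarith
  refine ⟨fun j => m j ^ (r / (2 - r)), fun j => (√(m j))⁻¹ • x j, fun j => by
    have := hm0 j; positivity, ?_, fun φ => ?_, fun j => ?_⟩
  · exact summable_of_sum_le (fun j => by have := hm0 j; positivity) hm
  · refine summable_of_sum_le (c := ‖φ‖ ^ 2 * K) (fun j => by positivity) fun s => ?_
    simp only [Real.rpow_two, sq_abs]
    set b : ℕ → ℝ := fun j => φ ((√(m j))⁻¹ • x j) with hb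
    set S := ∑ j ∈ s, b j ^ 2 with hS
    have hS0 : 0 ≤ S := by positivity
    have h1 : φ (∑ j ∈ s, (b j * (√(m j))⁻¹) • x j) = S := by
      simp only [map_sum, hS, mul_smul, map_smul, hb, smul_eq_mul]
      exact Finset.sum_congr rfl fun j _ => by ring
    have h2 : ∑ j ∈ s, (b j * (√(m j))⁻¹) ^ 2 * m j ≤ S := by
      refine Finset.sum_le_sum fun j _ => ?_
      rw [mul_pow, inv_pow, Real.sq_sqrt (hm0 j), mul_assoc]
      exact mul_le_of_le_one_right (by positivity) inv_mul_le_one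
    have h3 : S ^ 2 ≤ ‖φ‖ ^ 2 * (K * S) := by
      calc S ^ 2 = ‖φ (∑ j ∈ s, (b j * (√(m j))⁻¹) • x j)‖ ^ 2 := by
            rw [h1, Real.norm_eq_abs, sq_abs]
        _ ≤ (‖φ‖ * ‖∑ j ∈ s, (b j * (√(m j))⁻¹) • x j‖) ^ 2 := by
            gcongr; exact φ.le_opNorm _
        _ ≤ ‖φ‖ ^ 2 * (K * S) := by
            rw [mul_pow]
            gcongr
            exact (h s _).trans (by gcongr)
    rcases hS0.eq_or_lt with h0 | h0
    · rw [← h0]; positivity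
    · exact le_of_mul_le_mul_right (by linarith [h3]) h0
  · have he : r / (2 - r) * (1 / r - 1 / 2) = 1 / 2 := by field_simp
    rw [← Real.rpow_mul (hm0 j), he, ← Real.sqrt_eq_rpow]
    rcases (hm0 j).eq_or_lt with h0 | h0
    · have := h {j} fun _ => 1
      rw [Finset.sum_singleton, Finset.sum_singleton, ← h0, mul_zero, mul_zero, one_smul] at this
      have hx0 : x j = 0 := by
        rw [← norm_eq_zero]
        exact pow_eq_zero_iff two_ne_zero |>.1 (le_antisymm this (sq_nonneg _))
      simp [hx0]
    · rw [smul_inv_smul₀ (Real.sqrt_pos.2 h0).ne']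

lemma summable_rpow_mul_rpow {d b : ℕ → ℝ} (hd0 : ∀ j, 0 ≤ d j) (hb0 : ∀ j, 0 ≤ b j)
    (hd : Summable d) {s t : ℝ} (hs : 0 < s) (hst : s ≤ t) (hb : Summable fun j => b j ^ t) :
    Summable fun j => (d j ^ (1 / s - 1 / t) * b j) ^ s := by
  have ht : 0 < t := hs.trans_le hst
  refine Summable.of_nonneg_of_le (fun j => ?_) (fun j => ?_)
    ((hd.mul_left (1 - s / t)).add (hb.mul_left (s / t)))
  · have := hd0 j; have := hb0 j; positivity
  have h1 : (d j ^ (1 / s - 1 / t) * b j) ^ s = d j ^ (1 - s / t) * (b j ^ t) ^ (s / t) := by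
    rw [Real.mul_rpow (Real.rpow_nonneg (hd0 j) _) (hb0 j), ← Real.rpow_mul (hd0 j),
      ← Real.rpow_mul (hb0 j)]
    congr 2 <;> field_simp
  rw [h1]
  refine Real.geom_mean_le_arith_mean2_weighted ?_ (by positivity) (hd0 j)
    (Real.rpow_nonneg (hb0 j) _) (by ring)
  rw [sub_nonneg]; exact div_le_one_of_le₀ hst ht.le

/-- A consequence of the Abel–Dini theorem: the converse of Hölder's inequality for sequences. -/
lemma exists_summable_of_not_summable {d : ℕ → ℝ} (hd0 : ∀ j, 0 ≤ d j) (hd : ¬ Summable d)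
    {θ : ℝ} (hθ0 : 0 < θ) (hθ1 : θ < 1) :
    ∃ e : ℕ → ℝ, (∀ j, 0 ≤ e j) ∧ Summable e ∧
      ¬ Summable fun j => e j ^ θ * d j ^ (1 - θ) := by
  set S : ℕ → ℝ := fun n => 1 + ∑ i ∈ Finset.range n, d i with hS
  have hS1 : ∀ n, 1 ≤ S n := fun n => le_add_of_nonneg_right (Finset.sum_nonneg fun i _ => hd0 i)
  have hS0 : ∀ n, 0 < S n := fun n => zero_lt_one.trans_le (hS1 n)
  have hSs : ∀ n, S (n + 1) = S n + d n := fun n => by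
    simp only [hS, Finset.sum_range_succ]; ring
  have hmono : Monotone S := monotone_nat_of_le_succ fun n => by
    rw [hSs]; exact le_add_of_nonneg_right (hd0 n)
  set δ : ℝ := 1 / θ - 1 with hδ
  have hδ0 : 0 < δ := by
    rw [hδ, sub_pos, lt_div_iff₀ hθ0]; linarith
  refine ⟨fun j => d j * S (j + 1) ^ (-(1 / θ)), fun j =>
    mul_nonneg (hd0 j) (Real.rpow_nonneg (hS0 _).le _), ?_, fun hsum => ?_⟩
  · refine summable_of_sum_range_le (c := δ⁻¹) (fun j =>
      mul_nonneg (hd0 j) (Real.rpow_nonneg (hS0 _).le _)) fun n => ?_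
    have hterm : ∀ j, d j * S (j + 1) ^ (-(1 / θ)) ≤ δ⁻¹ * (S j ^ (-δ) - S (j + 1) ^ (-δ)) := by
      intro j
      have hx : 0 < S j / S (j + 1) := div_pos (hS0 j) (hS0 _)
      have hpow : 1 + δ * (1 - S j / S (j + 1)) ≤ (S j / S (j + 1)) ^ (-δ) := by
        rw [Real.rpow_def_of_pos hx]
        have h1 := Real.add_one_le_exp (Real.log (S j / S (j + 1)) * -δ)
        have h2 := Real.log_le_sub_one_of_pos hx
        nlinarith
      have hsplit : S j ^ (-δ) = (S j / S (j + 1)) ^ (-δ) * S (j + 1) ^ (-δ) := by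
        rw [← Real.mul_rpow hx.le (hS0 _).le, div_mul_cancel₀ _ (hS0 _).ne']
      have hexp : S (j + 1) ^ (-(1 / θ)) = S (j + 1) ^ (-δ) / S (j + 1) := by
        rw [← Real.rpow_sub_one (hS0 _).ne']; congr 1; rw [hδ]; ring
      have hdj : d j / S (j + 1) = 1 - S j / S (j + 1) := by
        rw [eq_sub_iff_add_eq, ← add_div, add_comm, ← hSs, div_self (hS0 _).ne']
      have hp : 0 < S (j + 1) ^ (-δ) := Real.rpow_pos_of_pos (hS0 _) _
      rw [hsplit, hexp, mul_div_left_comm, hdj, le_inv_mul_iff₀ hδ0]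
      nlinarith
    calc ∑ j ∈ Finset.range n, d j * S (j + 1) ^ (-(1 / θ))
        ≤ ∑ j ∈ Finset.range n, δ⁻¹ * (S j ^ (-δ) - S (j + 1) ^ (-δ)) :=
          Finset.sum_le_sum fun j _ => hterm j
      _ = δ⁻¹ * (S 0 ^ (-δ) - S n ^ (-δ)) := by
          rw [← Finset.mul_sum, Finset.sum_range_sub' fun j => S j ^ (-δ)]
      _ ≤ δ⁻¹ * 1 := by
          have h0 : S 0 ^ (-δ) = 1 := by simp [hS]
          have hn := Real.rpow_nonneg (hS0 n).le (-δ)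
          gcongr
          linarith
      _ = δ⁻¹ := mul_one _
  · have hq : ∀ j, (d j * S (j + 1) ^ (-(1 / θ))) ^ θ * d j ^ (1 - θ) = d j / S (j + 1) := by
      intro j
      rw [Real.mul_rpow (hd0 j) (Real.rpow_nonneg (hS0 _).le _), ← Real.rpow_mul (hS0 _).le,
        mul_right_comm, ← Real.rpow_add_of_nonneg (hd0 j) hθ0.le (by linarith), add_sub_cancel,
        Real.rpow_one, neg_mul, one_div_mul_cancel hθ0.ne', Real.rpow_neg_one, div_eq_mul_inv]
    simp only [hq] at hsum
    obtain ⟨s, hs⟩ := summable_iff_vanishing_norm.1 hsum (1 / 2) (by norm_num)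
    obtain ⟨N, hN⟩ := s.exists_nat_subset_range
    refine hd (summable_of_sum_range_le (c := 2 * S N) hd0 fun n => ?_)
    have hSn : S n ≤ 2 * S N := by
      rcases le_total n N with hnN | hNn
      · linarith [hmono hnN, hS0 N]
      have hlt := hs (Finset.Ico N n) (by
        rw [Finset.disjoint_left]
        intro j hj hjs
        have := Finset.mem_range.1 (hN hjs)
        have := (Finset.mem_Ico.1 hj).1
        omega)
      have hge : (S n - S N) / S n ≤ ∑ j ∈ Finset.Ico N n, d j / S (j + 1) := by
        have : S n - S N = ∑ j ∈ Finset.Ico N n, d j := by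
          rw [Finset.sum_Ico_eq_sub _ hNn]; simp only [hS]; ring
        rw [this, Finset.sum_div]
        refine Finset.sum_le_sum fun j hj => ?_
        exact div_le_div_of_nonneg_left (hd0 j) (hS0 _) (hmono (Finset.mem_Ico.1 hj).2)
      have h2 := hge.trans_lt ((le_abs_self _).trans_lt hlt)
      rw [div_lt_iff₀ (hS0 n)] at h2
      linarith
    have : S n = 1 + ∑ i ∈ Finset.range n, d i := rfl
    linarith

lemma AbsolutelySumming.inclusion {E F : Type*} [NormedAddCommGroup E] [NormedSpace ℝ E]
    [NormedAddCommGroup F] [NormedSpace ℝ F] {r r₁ a a₁ : ℝ} (hr : 0 < r) (hrr : r ≤ r₁)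
    (ha : 0 < a) (haa : a < a₁) (heq : 1 / r - 1 / r₁ = 1 / a - 1 / a₁) {u : E →L[ℝ] F}
    (hu : AbsolutelySumming a r u) : AbsolutelySumming a₁ r₁ u := by
  intro x hx
  by_contra hns
  have ha₁ : 0 < a₁ := ha.trans haa
  have h1 : a / a₁ < 1 := (div_lt_one ha₁).2 haa
  have h0 : 0 < a / a₁ := div_pos ha ha₁
  obtain ⟨e, he0, he, hne⟩ := exists_summable_of_not_summable (fun j => by positivity) hns
    (θ := 1 - a / a₁) (by linarith) (by linarith)
  refine hne ?_
  have hz := hu (fun j => e j ^ (1 / r - 1 / r₁) • x j) fun φ => by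
    have := summable_rpow_mul_rpow he0 (fun j => abs_nonneg (φ (x j))) he hr hrr (hx φ)
    simpa only [map_smul, smul_eq_mul, abs_mul, abs_of_nonneg (Real.rpow_nonneg (he0 _) _)]
      using this
  refine hz.congr fun j => ?_
  rw [map_smul, norm_smul, Real.norm_of_nonneg (Real.rpow_nonneg (he0 j) _),
    Real.mul_rpow (Real.rpow_nonneg (he0 j) _) (norm_nonneg _), ← Real.rpow_mul (he0 j),
    ← Real.rpow_mul (norm_nonneg _), heq]
  congr 2 <;> field_simp
  ring

lemma AbsolutelySumming.of_cotype {E F : Type*} [NormedAddCommGroup E] [NormedSpace ℝ E]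
    [NormedAddCommGroup F] [NormedSpace ℝ F] (hE : HasCotype 2 E) {r r₁ a a₁ : ℝ} (hr : 1 ≤ r)
    (hrr : r < r₁) (hr₁ : r₁ ≤ 2) (ha : 0 < a) (haa : a ≤ a₁)
    (heq : 1 / r - 1 / r₁ = 1 / a - 1 / a₁) {u : E →L[ℝ] F}
    (hu : AbsolutelySumming a₁ r₁ u) : AbsolutelySumming a r u := by
  intro x hx
  obtain ⟨d, y, hd0, hd, hy, hxy⟩ := hE.exists_factorization hr (hrr.trans_le hr₁) hx
  have hr0 : 0 < r := by linarith
  have hr₁0 : 0 < r₁ := by linarith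
  have hz := hu (fun j => d j ^ (1 / r₁ - 1 / 2) • y j) fun φ => by
    have := summable_rpow_mul_rpow hd0 (fun j => abs_nonneg (φ (y j))) hd hr₁0 hr₁ (hy φ)
    simpa only [map_smul, smul_eq_mul, abs_mul, abs_of_nonneg (Real.rpow_nonneg (hd0 _) _)]
      using this
  refine (summable_rpow_mul_rpow hd0 (fun j => norm_nonneg _) hd ha haa hz).congr fun j => ?_
  have hsplit : d j ^ (1 / r - 1 / 2) = d j ^ (1 / r - 1 / r₁) * d j ^ (1 / r₁ - 1 / 2) := by
    rw [← Real.rpow_add_of_nonneg (hd0 j), sub_add_sub_cancel]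
    · rw [sub_nonneg]; exact one_div_le_one_div_of_le hr0 hrr.le
    · rw [sub_nonneg]; exact one_div_le_one_div_of_le hr₁0 hr₁
  rw [hxy, hsplit, heq, mul_smul, map_smul u (d j ^ (1 / a - 1 / a₁)), norm_smul,
    Real.norm_of_nonneg (Real.rpow_nonneg (hd0 j) _)]

/-- strings of coincidences, cotype 2 case. -/
theorem stmt7 (E F : Type*) [NormedAddCommGroup E] [NormedSpace ℝ E] [CompleteSpace E]
    [NormedAddCommGroup F] [NormedSpace ℝ F] [CompleteSpace F]
    (hE : ¬ FiniteDimensional ℝ E) (hF : ¬ FiniteDimensional ℝ F)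
    (hcot : HasCotype 2 E)
    (r r₁ a a₁ : ℝ) (hr : 1 ≤ r) (hrr : r ≤ r₁) (hr₁ : r₁ ≤ 2)
    (hra : r ≤ a) (haa : a ≤ a₁)
    (heq : 1 / r - 1 / a = 1 / r₁ - 1 / a₁) (u : E →L[ℝ] F) :
    AbsolutelySumming a r u ↔ AbsolutelySumming a₁ r₁ u := by
  have ha : 0 < a := by linarith
  have heq' : 1 / r - 1 / r₁ = 1 / a - 1 / a₁ := by linarith
  rcases hrr.eq_or_lt with rfl | hlt
  · have : a = a₁ := by
      rw [sub_self] at heq'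
      exact inv_injective (by simpa only [one_div] using sub_eq_zero.1 heq'.symm)
    rw [this]
  · have haa' : a < a₁ := by
      refine haa.lt_of_ne fun h => ?_
      rw [h, sub_self, sub_eq_zero] at heq'
      exact hlt.ne (inv_injective (by simpa only [one_div] using heq'))
    exact ⟨fun h => h.inclusion (by linarith) hrr ha haa' heq',
      fun h => h.of_cotype hcot hr hlt hr₁ ha haa heq'⟩

end
end
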